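/- arXiv:1904.06981 — 6 statements merged into one kernel-verified Lean document; each statement's English description precedes it below -/
import Mathlib

section
/- Let m ≥ 1 be an integer, let p be a real with 1/m < p ≤ 1, and let X be binomially distributed with parameters m and p. Then Pr(X ≥ E[X]) > 1/4, i.e., Pr(X ≥ m·p) > 1/4. -/
open Finset
open scoped ENNReal

attribute [local instance] Classical.propDecidable

/-- Search points: bit strings of length `n`. -/
abbrev Pt (n : ℕ) := Fin n → Bool

/-- The OneMax fitness: the number of one-bits. -/
noncomputable def oneMax {n : ℕ} (x : Pt n) : ℕ := (univ.filter (fun i => x i = true)).card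

/-- The all-ones string (the unique optimum of OneMax). -/
noncomputable def allOnes (n : ℕ) : Pt n := fun _ => true

/-- Probability that standard-bit mutation (flip each bit independently with
probability `1/n`) turns `x` into `y`. -/
noncomputable def mutProb (n : ℕ) (x y : Pt n) : ℝ :=
  ∏ i : Fin n, (if y i = x i then 1 - 1 / (n : ℝ) else 1 / (n : ℝ))

/-- `binomPr m p k` is the probability that a `Bin(m, p)` random variable equals `k`. -/
noncomputable def binomPr (m : ℕ) (p : ℝ) (k : ℕ) : ℝ :=
  (m.choose k : ℝ) * p ^ k * (1 - p) ^ (m - k)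

/-- Probability that `min μ B = j`, where `B ~ Bin(lam, p)`. -/
noncomputable def binomTruncPr (μ lam : ℕ) (p : ℝ) (j : ℕ) : ℝ :=
  if j < μ then binomPr lam p j
  else if j = μ then ∑ k ∈ Finset.Icc μ lam, binomPr lam p k
  else 0

/-- The potential of a single individual. -/
noncomputable def gPot (n : ℕ) (τ : ℝ) (f₀ : ℕ) (x : Pt n) : ℝ :=
  if f₀ ≤ oneMax x then τ ^ (oneMax x - f₀) else 0

/-- The potential of a population. -/
noncomputable def gPop (n μ : ℕ) (τ : ℝ) (f₀ : ℕ) (P : Fin μ → Pt n) : ℝ :=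
  ∑ i, gPot n τ f₀ (P i)

/-- Probability that one offspring-creation step (choose a parent uniformly at random
from the population `P`, then apply standard-bit mutation) produces `y`. -/
noncomputable def offProb (n μ : ℕ) (P : Fin μ → Pt n) (y : Pt n) : ℝ :=
  (∑ i, mutProb n (P i) y) / (μ : ℝ)

/-- Probability that the `lam` independently created offspring are exactly `o`. -/
noncomputable def offVecProb (n μ lam : ℕ) (P : Fin μ → Pt n) (o : Fin lam → Pt n) : ℝ :=
  ∏ j, offProb n μ P (o j)

/-- `s` selects `μ` of the `lam` offspring `o` having the largest OneMax values. -/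
def validSel {n μ lam : ℕ} (o : Fin lam → Pt n) (s : Fin μ → Fin lam) : Prop :=
  Function.Injective s ∧
    ∀ j : Fin lam, (∀ i, s i ≠ j) → ∀ i, oneMax (o j) ≤ oneMax (o (s i))

/-- Transition probability of the (μ,λ) EA on OneMax: the probability that the next
population is `Q`, given that the current one is `P`; the `μ` best of the `lam`
offspring are selected, ties broken uniformly at random. -/
noncomputable def stepProb (n μ lam : ℕ) (P Q : Fin μ → Pt n) : ℝ :=
  ∑ o : Fin lam → Pt n, offVecProb n μ lam P o *
    (((univ.filter (fun s : Fin μ → Fin lam => validSel o s ∧ o ∘ s = Q)).card : ℝ) /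
      ((univ.filter (fun s : Fin μ → Fin lam => validSel o s)).card : ℝ))

/-- Probability of observing the population path `path`, where the initial population
consists of `μ` individuals chosen independently and uniformly at random. -/
noncomputable def pathProb (n μ lam : ℕ) {t : ℕ} (path : Fin (t + 1) → Fin μ → Pt n) : ℝ :=
  ((1 : ℝ) / 2 ^ n) ^ μ * ∏ s : Fin t, stepProb n μ lam (path s.castSucc) (path s.succ)

/-- Probability that none of the populations `P_0, …, P_t` contains the optimum. -/
noncomputable def survProb (n μ lam t : ℕ) : ℝ :=
  ∑ path ∈ (univ : Finset (Fin (t + 1) → Fin μ → Pt n)).filter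
      (fun path => ∀ s i, path s i ≠ allOnes n),
    pathProb n μ lam path

/-- Expected number of generations of the (μ,λ) EA on OneMax until the all-ones
string is first generated. -/
noncomputable def expGens (n μ lam : ℕ) : ℝ≥0∞ :=
  ∑' t : ℕ, ENNReal.ofReal (survProb n μ lam t)

/-- Expected runtime (number of fitness evaluations) of the (μ,λ) EA on OneMax:
`μ` evaluations for the initial population plus `lam` per generation. -/
noncomputable def expRuntime (n μ lam : ℕ) : ℝ≥0∞ :=
  (μ : ℝ≥0∞) + (lam : ℝ≥0∞) * expGens n μ lam

/-- Number of individuals of the population with fitness exactly `φ`. -/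
noncomputable def cntEq {n μ : ℕ} (P : Fin μ → Pt n) (φ : ℕ) : ℕ :=
  (univ.filter (fun i => oneMax (P i) = φ)).card

/-- Number of individuals of the population with fitness strictly greater than `φ`. -/
noncomputable def cntGt {n μ : ℕ} (P : Fin μ → Pt n) (φ : ℕ) : ℕ :=
  (univ.filter (fun i => φ < oneMax (P i))).card

/-- `φ` is the current level at generation `t` of the population path `path`. -/
def isCurLevel {n : ℕ} (μ : ℕ) (path : ℕ → Fin μ → Pt n) (t φ : ℕ) : Prop :=
  ∃ t₀ < t, (μ : ℝ) / 2 ≤ (cntEq (path t₀) φ : ℝ) + (cntGt (path t₀) φ : ℝ) ∧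
    ∀ τ, t₀ ≤ τ → τ ≤ t →
      (μ : ℝ) / 4 ≤ (cntEq (path τ) φ : ℝ) + (cntGt (path τ) φ : ℝ) ∧
        (cntGt (path τ) φ : ℝ) < (μ : ℝ) / 2

/-- Probability that the population path of length `t + 1` of the (μ,λ) EA started
from the fixed population `P₀` satisfies the predicate `good`. -/
noncomputable def prEvent (n μ lam : ℕ) (P₀ : Fin μ → Pt n) (t : ℕ)
    (good : (Fin (t + 1) → Fin μ → Pt n) → Prop) : ℝ :=
  ∑ path ∈ (univ : Finset (Fin (t + 1) → Fin μ → Pt n)).filter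
      (fun path => path 0 = P₀ ∧ good path),
    ∏ s : Fin t, stepProb n μ lam (path s.castSucc) (path s.succ)

/-- The population `Q` has lost the level `φ`: fewer than `μ/4` individuals have
fitness at least `φ`. -/
def lostLevel {n μ : ℕ} (φ : ℕ) (Q : Fin μ → Pt n) : Prop :=
  (cntEq Q φ : ℝ) + (cntGt Q φ : ℝ) < (μ : ℝ) / 4

/-- The population `Q` has gained a level over `φ`: at least `μ/2` individuals have
fitness strictly greater than `φ`. -/
def gainLevel {n μ : ℕ} (φ : ℕ) (Q : Fin μ → Pt n) : Prop :=
  (μ : ℝ) / 2 ≤ (cntGt Q φ : ℝ)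

noncomputable def qB (m k : ℕ) (a : ℝ) : ℝ := (bernsteinPolynomial ℝ m k).eval a

lemma qB_eq (m k : ℕ) (a : ℝ) : qB m k a = binomPr m a k := by
  simp [qB, binomPr, bernsteinPolynomial]

noncomputable def qL (m j : ℕ) (a : ℝ) : ℝ := ∑ i ∈ Finset.range (j + 1), qB m i a

lemma qB_deriv_zero (M : ℕ) (a : ℝ) :
    HasDerivAt (qB (M+1) 0) (-((M:ℝ)+1) * qB M 0 a) a := by
  have h := (bernsteinPolynomial ℝ (M+1) 0).hasDerivAt a
  rw [bernsteinPolynomial.derivative_zero] at h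
  refine HasDerivAt.congr_deriv (f := qB (M+1) 0) h ?_
  simp [qB]

lemma qB_deriv_succ (M k : ℕ) (a : ℝ) :
    HasDerivAt (qB (M+1) (k+1)) (((M:ℝ)+1) * (qB M k a - qB M (k+1) a)) a := by
  have h := (bernsteinPolynomial ℝ (M+1) (k+1)).hasDerivAt a
  rw [bernsteinPolynomial.derivative_succ] at h
  refine HasDerivAt.congr_deriv (f := qB (M+1) (k+1)) h ?_
  simp [qB]

lemma qL_succ (m j : ℕ) (a : ℝ) : qL m (j+1) a = qL m j a + qB m (j+1) a := by
  simp [qL, Finset.sum_range_succ _ (j+1)]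

lemma qL_deriv (M j : ℕ) (a : ℝ) :
    HasDerivAt (qL (M+1) j) (-((M:ℝ)+1) * qB M j a) a := by
  induction j with
  | zero =>
    have : qL (M+1) 0 = qB (M+1) 0 := by funext x; simp [qL]
    rw [this]; exact qB_deriv_zero M a
  | succ j ih =>
    have : qL (M+1) (j+1) = fun x => qL (M+1) j x + qB (M+1) (j+1) x := by
      funext x; exact qL_succ _ _ _
    rw [this]
    refine (ih.add (qB_deriv_succ M j a)).congr_deriv ?_
    ring

lemma qB_zero_rec (m : ℕ) (a : ℝ) : qB (m+1) 0 a = (1-a) * qB m 0 a := by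
  simp [qB_eq, binomPr, pow_succ]; ring

lemma qB_rec (m k : ℕ) (a : ℝ) :
    qB (m+1) (k+1) a = a * qB m k a + (1-a) * qB m (k+1) a := by
  simp only [qB_eq, binomPr, Nat.choose_succ_succ, Nat.add_sub_add_right]
  rcases Nat.lt_or_ge k m with h | h
  · obtain ⟨d, rfl⟩ := Nat.exists_eq_add_of_lt h
    have h1 : k + d + 1 - k = d + 1 := by omega
    have h2 : k + d + 1 - (k+1) = d := by omega
    rw [h1, h2]; push_cast; ring
  · rw [Nat.choose_eq_zero_of_lt (show m < k+1 by omega)]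
    push_cast; ring

lemma qL_rec (m j : ℕ) (a : ℝ) : qL (m+1) j a = qL m j a - a * qB m j a := by
  induction j with
  | zero => simp [qL, qB_zero_rec]; ring
  | succ j ih => rw [qL_succ, qL_succ, ih, qB_rec]; ring

lemma qB_nonneg (m k : ℕ) (a : ℝ) (h0 : 0 ≤ a) (h1 : a ≤ 1) : 0 ≤ qB m k a := by
  rw [qB_eq, binomPr]
  have : 0 ≤ 1 - a := by linarith
  positivity

lemma qB_pos (m k : ℕ) (hk : k ≤ m) (a : ℝ) (h0 : 0 < a) (h1 : a < 1) : 0 < qB m k a := by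
  rw [qB_eq, binomPr]
  have : 0 < 1 - a := by linarith
  have := Nat.choose_pos hk
  positivity

/-- ratio of consecutive probabilities -/
lemma qB_ratio (M i : ℕ) (hi : i + 1 ≤ M + 1) (a : ℝ) (h0 : 0 ≤ a) (h1 : a ≤ 1)
    (h : ((M:ℝ)+1) * a ≤ i + 1) : qB M (i+1) a ≤ qB M i a := by
  simp only [qB_eq, binomPr]
  rcases Nat.lt_or_ge i M with h' | h'
  · obtain ⟨d, rfl⟩ := Nat.exists_eq_add_of_lt h'
    have e1 : i + d + 1 - i = d + 1 := by omega
    have e2 : i + d + 1 - (i+1) = d := by omega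
    have hc := Nat.choose_succ_right_eq (i+d+1) i
    rw [e1] at hc
    rw [e1, e2]
    have hc' : ((i+d+1).choose (i+1) : ℝ) * (i+1) = (i+d+1).choose i * (d+1) := by exact_mod_cast hc
    push_cast at h
    have h1' : 0 ≤ 1 - a := by linarith
    have key : ((i+d+1).choose (i+1) : ℝ) * a ≤ (i+d+1).choose i * (1-a) := by
      have hi0 : (0:ℝ) < i + 1 := by positivity
      refine le_of_mul_le_mul_right ?_ hi0
      have hC : (0:ℝ) ≤ (i+d+1).choose i := by positivity
      nlinarith [mul_le_mul_of_nonneg_left (show ((d:ℝ)+1) * a ≤ (1-a)*(i+1) by nlinarith) hC]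
    have hp : 0 ≤ a^i * (1-a)^d := by positivity
    calc _ = ((i+d+1).choose (i+1) : ℝ) * a * (a^i * (1-a)^d) := by ring
      _ ≤ (i+d+1).choose i * (1-a) * (a^i * (1-a)^d) := mul_le_mul_of_nonneg_right key hp
      _ = _ := by ring
  · rw [Nat.choose_eq_zero_of_lt (show M < i+1 by omega)]
    have h1' : 0 ≤ 1 - a := by linarith
    simp only [Nat.cast_zero, zero_mul]
    positivity

lemma step (M i : ℕ) (hi : i ≤ M) :
    qL (M+2) (i+1) (((i:ℝ)+1)/(M+2)) ≤ qL (M+1) (i+1) (((i:ℝ)+1)/(M+1)) := by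
  set l : ℝ := ((i:ℝ)+1)/(M+2) with hl
  set u : ℝ := ((i:ℝ)+1)/(M+1) with hu
  have hiM : (i:ℝ) ≤ M := by exact_mod_cast hi
  have hl0 : 0 ≤ l := by positivity
  have hlu : l ≤ u := by rw [hl, hu]; gcongr; norm_num
  have hu1 : u ≤ 1 := by rw [hu, div_le_one (by positivity)]; linarith
  have hlm : l * (M+2) = i+1 := by rw [hl]; field_simp
  have hum : u * (M+1) = i+1 := by rw [hu]; field_simp
  let G : ℝ → ℝ := fun a => qL (M+1) (i+1) a - ((i+1:ℝ) - (M+1)*a) * qB (M+1) (i+1) a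
  have hG : ∀ a, HasDerivAt G (((M:ℝ)+1) * (a - ((i+1:ℝ) - (M+1)*a)) * (qB M i a - qB M (i+1) a)) a := by
    intro a
    have h1 : HasDerivAt (fun a : ℝ => ((i+1:ℝ) - (M+1)*a)) (-(M+1:ℝ)) a := by
      simpa using ((hasDerivAt_id a).const_mul (M+1:ℝ)).const_sub (i+1:ℝ)
    refine ((qL_deriv M (i+1) a).sub (h1.mul (qB_deriv_succ M i a))).congr_deriv ?_
    rw [qB_rec]; ring
  have hmono : MonotoneOn G (Set.Icc l u) := by
    apply monotoneOn_of_deriv_nonneg (convex_Icc l u)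
    · exact fun x _ => (hG x).continuousAt.continuousWithinAt
    · exact fun x _ => (hG x).differentiableAt.differentiableWithinAt
    · intro x hx
      rw [interior_Icc] at hx
      rw [(hG x).deriv]
      have hx1 := hx.1
      have hx2 := hx.2
      have hr := qB_ratio M i (by omega) x (by linarith) (by linarith)
        (by nlinarith [(Nat.cast_nonneg M : (0:ℝ) ≤ M)])
      apply mul_nonneg
      · apply mul_nonneg (by positivity)
        nlinarith [(Nat.cast_nonneg M : (0:ℝ) ≤ M)]
      · linarith
  have h := hmono (Set.left_mem_Icc.2 hlu) (Set.right_mem_Icc.2 hlu) hlu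
  have e1 : G u = qL (M+1) (i+1) u := by
    have : ((i+1:ℝ) - (M+1)*u) = 0 := by linarith
    simp only [G, this]; ring
  have e2 : G l = qL (M+2) (i+1) l := by
    have : ((i+1:ℝ) - (M+1)*l) = l := by linarith
    rw [qL_rec]; simp only [G, this]
  rw [e1, e2] at h
  exact h

lemma qL_total (m : ℕ) (a : ℝ) : qL m m a = 1 := by
  have h := congrArg (Polynomial.eval a) (bernsteinPolynomial.sum ℝ m)
  simpa [Polynomial.eval_finsetSum, qL, qB] using h

lemma quarter (n : ℕ) (hn : 2 ≤ n) : (1:ℝ)/4 ≤ (1 - 1/(n:ℝ))^n := by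
  have hn' : (2:ℝ) ≤ n := by exact_mod_cast hn
  have h0 : (1:ℝ)/n ≤ 1 := by rw [div_le_one (by linarith)]; linarith
  have h := one_add_mul_self_le_rpow_one_add (s := -(1/(n:ℝ))) (by linarith)
    (p := (n:ℝ)/2) (by linarith)
  have e : 1 + (n:ℝ)/2 * -(1/(n:ℝ)) = 1/2 := by field_simp; norm_num
  rw [e] at h
  have hb : (0:ℝ) ≤ 1 + -(1/(n:ℝ)) := by linarith
  have e2 : ((1 + -(1/(n:ℝ)))^((n:ℝ)/2))^2 = (1 - 1/(n:ℝ))^n := by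
    rw [← Real.rpow_natCast, ← Real.rpow_mul hb, ← Real.rpow_natCast, ← sub_eq_add_neg]
    congr 1; push_cast; ring
  rw [← e2]
  nlinarith

lemma base (i : ℕ) : qL (i+2) (i+1) (((i:ℝ)+1)/(i+2)) ≤ 3/4 := by
  have h := qL_total (i+2) (((i:ℝ)+1)/(i+2))
  rw [qL_succ] at h
  have h2 : qB (i+2) (i+1+1) (((i:ℝ)+1)/(i+2)) = (1 - 1/((i+2:ℕ):ℝ))^(i+2) := by
    rw [qB_eq, binomPr]
    have : ((i:ℝ)+1)/(i+2) = 1 - 1/((i+2:ℕ):ℝ) := by push_cast; field_simp; ring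
    rw [this]; simp
  have := quarter (i+2) (by omega)
  linarith

lemma int_mean (i d : ℕ) : qL (i+d+2) (i+1) (((i:ℝ)+1)/(i+d+2)) ≤ 3/4 := by
  induction d with
  | zero => simpa using base i
  | succ d ih =>
    have h := step (i+d+1) i (by omega)
    have e : i + d + 1 + 2 = i + (d+1) + 2 := by omega
    rw [e] at h
    push_cast at h ⊢
    have e1 : (i:ℝ) + d + 1 + 2 = i + (d+1) + 2 := by ring
    have e2 : (i:ℝ) + d + 1 + 1 = i + d + 2 := by ring
    rw [e1, e2] at h
    exact h.trans ih

lemma qL_anti (M j : ℕ) (hj : j ≤ M) : StrictAntiOn (qL (M+1) j) (Set.Icc 0 1) := by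
  apply strictAntiOn_of_deriv_neg (convex_Icc 0 1)
  · exact fun x _ => (qL_deriv M j x).continuousAt.continuousWithinAt
  · intro x hx
    rw [interior_Icc] at hx
    rw [(qL_deriv M j x).deriv]
    have := qB_pos M j hj x hx.1 hx.2
    have : 0 < ((M:ℝ)+1) * qB M j x := by positivity
    linarith

/-- For `m ≥ 1`, `1/m < p ≤ 1` and `X ~ Bin(m,p)`,
`Pr(X ≥ E[X]) = Pr(X ≥ mp) > 1/4`. -/
theorem stmt3 (m : ℕ) (hm : 1 ≤ m) (p : ℝ) (hp₁ : 1 / (m : ℝ) < p) (hp₂ : p ≤ 1) :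
    (1 : ℝ) / 4 <
      ∑ k ∈ (Finset.range (m + 1)).filter (fun k : ℕ => (m : ℝ) * p ≤ (k : ℝ)),
        binomPr m p k := by
  have hm0 : (0:ℝ) < m := by exact_mod_cast hm
  have hmp : 1 < (m:ℝ) * p := by rwa [div_lt_iff₀ hm0, mul_comm] at hp₁
  have hmp2 : (m:ℝ) * p ≤ m := by nlinarith
  have hc1 : 1 < ⌈(m:ℝ) * p⌉₊ := by rw [Nat.lt_ceil]; simpa using hmp
  have hc2 : ⌈(m:ℝ) * p⌉₊ ≤ m := Nat.ceil_le.2 hmp2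
  obtain ⟨i, hi⟩ : ∃ i, ⌈(m:ℝ) * p⌉₊ = i + 2 := ⟨⌈(m:ℝ) * p⌉₊ - 2, by omega⟩
  obtain ⟨d, hd⟩ : ∃ d, m = i + d + 2 := ⟨m - (i+2), by omega⟩
  have hlt : ((i:ℝ)+1) < m * p := by
    have : i + 1 < ⌈(m:ℝ) * p⌉₊ := by omega
    rw [Nat.lt_ceil] at this; exact_mod_cast this
  have hL : qL m (i+1) p < 3/4 := by
    subst hd
    have h := int_mean i d
    push_cast at hlt
    have hpos : (0:ℝ) < i + d + 2 := by positivity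
    have h1 : ((i:ℝ)+1)/(i+d+2) < p := by rw [div_lt_iff₀ hpos]; linarith
    have h0 : 0 ≤ ((i:ℝ)+1)/(i+d+2) := by positivity
    have := qL_anti (i+d+1) (i+1) (by omega) (a := ((i:ℝ)+1)/(i+d+2)) (b := p)
      ⟨h0, by linarith⟩ ⟨by linarith, hp₂⟩ h1
    exact this.trans_le h
  have hT := qL_total m p
  have hsplit := Finset.sum_filter_add_sum_filter_not (Finset.range (m+1))
    (fun k : ℕ => (m : ℝ) * p ≤ (k : ℝ)) (fun k => binomPr m p k)
  have hset : (Finset.range (m+1)).filter (fun k : ℕ => ¬ (m : ℝ) * p ≤ (k : ℝ))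
      = Finset.range (i+1+1) := by
    ext k
    simp only [Finset.mem_filter, Finset.mem_range]
    rw [← Nat.ceil_le, hi]
    omega
  rw [hset] at hsplit
  simp only [qL, qB_eq] at hT hL
  linarith
end

section
/- There exists a constant S_min > 0 such that for every integer n ≥ 1 and every real p ∈ (0,1] with n·p ≥ S_min, if X is binomially distributed with parameters n and p, then E[ln(1 + X)] ≥ ln(1 + n·p) − (11/12)·(1 − p)/(n·p). -/
open Finset
open scoped ENNReal

attribute [local instance] Classical.propDecidable

theorem aux_poly (s : ℝ) (hs : 0 < s) : s^2 + 2*s ≤ (s+1)^2*(1/2 + 5/12*s^2) := by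
  nlinarith [sq_nonneg (s^2 + s/2 - 3/5), sq_nonneg (s-1/2), sq_nonneg (s^2-s), mul_pos hs hs, mul_nonneg hs.le (sq_nonneg (s-1/2)), mul_nonneg hs.le (sq_nonneg (s-3/5)), sq_nonneg (s^2-1/4)]

theorem aux_log (y : ℝ) (hy : 0 < y) :
    (y - 1) - 1/2 * (1/y - 2 + y) - 5/12 * (y-1)^2 ≤ Real.log y := by
  obtain ⟨s, hs, rfl⟩ : ∃ s : ℝ, 0 < s ∧ y = s^2 :=
    ⟨Real.sqrt y, Real.sqrt_pos.2 hy, (Real.sq_sqrt hy.le).symm⟩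
  have h1 := Real.one_sub_inv_le_log_of_pos hs
  have h2 := aux_poly s hs
  rw [Real.log_pow]
  push_cast
  have h3 : 2 * (1 - s⁻¹) - ((s^2 - 1) - 1/2 * (1/s^2 - 2 + s^2) - 5/12 * (s^2-1)^2)
      = (s-1)^2/s^2 * ((s+1)^2*(1/2 + 5/12*s^2) - (s^2+2*s)) := by
    field_simp
    ring
  have h4 : 0 ≤ (s-1)^2/s^2 * ((s+1)^2*(1/2 + 5/12*s^2) - (s^2+2*s)) :=
    mul_nonneg (by positivity) (by linarith)
  linarith

theorem aux_bern (n k : ℕ) (p : ℝ) : (bernsteinPolynomial ℝ n k).eval p = binomPr n p k := by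
  simp [bernsteinPolynomial, binomPr]

theorem aux_sum (n : ℕ) (p : ℝ) : ∑ k ∈ range (n+1), binomPr n p k = 1 := by
  have h := congrArg (Polynomial.eval p) (bernsteinPolynomial.sum ℝ n)
  simpa [Polynomial.eval_finsetSum, aux_bern] using h

theorem aux_mean (n : ℕ) (p : ℝ) : ∑ k ∈ range (n+1), binomPr n p k * k = n * p := by
  have h := congrArg (Polynomial.eval p) (bernsteinPolynomial.sum_smul ℝ n)
  simpa [Polynomial.eval_finsetSum, aux_bern, mul_comm] using h

theorem aux_var (n : ℕ) (p : ℝ) :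
    ∑ k ∈ range (n+1), binomPr n p k * ((k:ℝ) - n*p)^2 = n * p * (1-p) := by
  have h := congrArg (Polynomial.eval p) (bernsteinPolynomial.variance ℝ n)
  simp [Polynomial.eval_finsetSum, aux_bern] at h
  rw [← h]
  refine Finset.sum_congr rfl fun k _ => ?_
  ring

theorem aux_inv (n : ℕ) (p : ℝ) (hp : 0 < p) (hp1 : p ≤ 1) :
    ∑ k ∈ range (n+1), binomPr n p k * (1 / (1 + (k:ℝ))) ≤ 1 / ((n+1) * p) := by
  rw [le_div_iff₀ (by positivity), Finset.sum_mul]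
  have h := aux_sum (n+1) p
  rw [Finset.sum_range_succ'] at h
  have h0 : 0 ≤ binomPr (n+1) p 0 := by
    unfold binomPr
    have : 0 ≤ 1 - p := by linarith
    positivity
  refine le_trans (le_of_eq (Finset.sum_congr rfl fun k _ => ?_)) (by linarith : _ ≤ (1:ℝ))
  · have hc : ((n:ℝ)+1) * n.choose k = (n+1).choose (k+1) * (k+1) := by
      exact_mod_cast Nat.add_one_mul_choose_eq n k
    have hk : (1 + (k:ℝ)) ≠ 0 := by positivity
    simp only [binomPr, Nat.add_sub_add_right]
    field_simp
    rw [pow_succ]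
    linear_combination (p^k * p * (1-p)^(n-k)) * hc

/-- There is a constant `S_min > 0` such that whenever `X ~ Bin(n,p)`
with `n·p ≥ S_min`, one has `E[ln(1+X)] ≥ ln(1+np) - (11/12)(1-p)/(np)`. -/
theorem stmt4 :
    ∃ Smin : ℝ, 0 < Smin ∧
      ∀ n : ℕ, 1 ≤ n → ∀ p : ℝ, 0 < p → p ≤ 1 → Smin ≤ (n : ℝ) * p →
        Real.log (1 + (n : ℝ) * p) - (11 / 12) * (1 - p) / ((n : ℝ) * p)
          ≤ ∑ k ∈ Finset.range (n + 1), binomPr n p k * Real.log (1 + (k : ℝ)) := by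
  refine ⟨1, one_pos, fun n hn p hp hp1 _ => ?_⟩
  have hn0 : (0:ℝ) < n := by exact_mod_cast hn
  have hnp : 0 < (n:ℝ) * p := by positivity
  obtain ⟨m, hm⟩ : ∃ m : ℝ, m = 1 + (n:ℝ) * p := ⟨_, rfl⟩
  have hm0 : 0 < m := by linarith
  rw [← hm]
  have hq : 0 ≤ 1 - p := by linarith
  have hb : ∀ k, 0 ≤ binomPr n p k := fun k => by unfold binomPr; positivity
  have key : ∑ k ∈ range (n+1), binomPr n p k * (Real.log m + 1/2 * (((k:ℝ) - n*p)/m) + 1/2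
      - 1/2 * m * (1/(1+(k:ℝ))) - 5/12/m^2 * ((k:ℝ) - n*p)^2)
      ≤ ∑ k ∈ range (n+1), binomPr n p k * Real.log (1 + (k:ℝ)) := by
    refine Finset.sum_le_sum fun k _ => mul_le_mul_of_nonneg_left ?_ (hb k)
    have hk : 0 < 1 + (k:ℝ) := by positivity
    have h := aux_log ((1+(k:ℝ))/m) (by positivity)
    rw [Real.log_div hk.ne' hm0.ne'] at h
    refine le_trans (le_of_eq ?_) (by linarith [h] :
      Real.log m + ((1+(k:ℝ))/m - 1 - 1/2 * (1/((1+(k:ℝ))/m) - 2 + (1+(k:ℝ))/m)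
        - 5/12 * ((1+(k:ℝ))/m-1)^2) ≤ _)
    have e : (k:ℝ) - n*p = (1 + k) - m := by rw [hm]; ring
    rw [e]
    field_simp
    ring
  refine le_trans ?_ key
  have e : ∑ k ∈ range (n+1), binomPr n p k * (Real.log m + 1/2 * (((k:ℝ) - n*p)/m) + 1/2
      - 1/2 * m * (1/(1+(k:ℝ))) - 5/12/m^2 * ((k:ℝ) - n*p)^2)
      = (Real.log m + 1/2 - 1/2/m * (n*p)) * ∑ k ∈ range (n+1), binomPr n p k
        + 1/2/m * ∑ k ∈ range (n+1), binomPr n p k * k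
        - 1/2 * m * ∑ k ∈ range (n+1), binomPr n p k * (1/(1+(k:ℝ)))
        - 5/12/m^2 * ∑ k ∈ range (n+1), binomPr n p k * ((k:ℝ) - n*p)^2 := by
    simp only [Finset.mul_sum, ← Finset.sum_add_distrib, ← Finset.sum_sub_distrib]
    refine Finset.sum_congr rfl fun k _ => ?_
    ring
  rw [e, aux_sum, aux_mean, aux_var]
  have hi := mul_le_mul_of_nonneg_left (aux_inv n p hp hp1) (by positivity : 0 ≤ 1/2*m)
  have h1 : 1/2 * m * (1/(((n:ℝ)+1)*p)) ≤ 1/2 + 1/2 * ((1-p)/(n*p)) := by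
    have : 1/2 * m * (1/(((n:ℝ)+1)*p)) = 1/2 + 1/2 * ((1-p)/((n+1)*p)) := by
      rw [hm]; field_simp; ring
    rw [this]
    have : (1-p)/(((n:ℝ)+1)*p) ≤ (1-p)/(n*p) := by
      apply div_le_div_of_nonneg_left hq hnp
      nlinarith
    linarith
  have h2 : 5/12/m^2 * (n*p*(1-p)) ≤ 5/12 * ((1-p)/(n*p)) := by
    have : 5/12/m^2 * (n*p*(1-p)) = 5/12 * ((1-p)/(n*p)) * ((n*p)^2/m^2) := by
      field_simp
    rw [this]
    apply mul_le_of_le_one_right (by positivity)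
    rw [div_le_one (by positivity)]
    apply pow_le_pow_left₀ hnp.le
    linarith
  have h3 : 11/12*(1-p)/((n:ℝ)*p) = 1/2 * ((1-p)/(n*p)) + 5/12 * ((1-p)/(n*p)) := by ring
  have h4 : (Real.log m + 1/2 - 1/2/m * (n*p)) * 1 + 1/2/m*(n*p) = Real.log m + 1/2 := by ring
  linarith
end

section
/- Let μ, λ be positive integers with λ ≥ e·μ. Let (X_t)_{t∈ℕ} be a Markov chain with values in {0,1,…,μ}, deterministic starting value X_0, and transition law: conditionally on X_t, X_{t+1} is distributed as min{μ, B} where B ~ Bin(λ, X_t/(e·μ)). Then for every t ∈ ℕ and every real Δ > 0, the probability that X_τ < X_0 − Δ for some τ ∈ {1,…,t} is at most t·X_0/Δ². -/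
open Finset
open scoped ENNReal

attribute [local instance] Classical.propDecidable

noncomputable def pathW {α : Type*} [Fintype α] (K : α → α → ℝ) (t : ℕ) (x : α)
    (P : (Fin (t + 1) → α) → Prop) : ℝ :=
  ∑ q : Fin (t + 1) → α, if q 0 = x ∧ P q then ∏ s : Fin t, K (q s.castSucc) (q s.succ) else 0

lemma pathW_zero_aux {α : Type*} [Fintype α] (K : α → α → ℝ) (x : α)
    (P : (Fin 1 → α) → Prop) : pathW K 0 x P = if P (fun _ => x) then 1 else 0 := by
  unfold pathW
  rw [Finset.sum_eq_single (fun _ => x)]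
  · simp
  · intro b _ hb
    rw [if_neg]
    rintro ⟨h, _⟩
    apply hb
    funext i
    have hi : i = 0 := Fin.ext (by omega)
    rw [hi, h]
  · simp

lemma pathW_succ_aux {α : Type*} [Fintype α] (K : α → α → ℝ) (t : ℕ) (x : α)
    (P : (Fin (t + 2) → α) → Prop) :
    pathW K (t + 1) x P = ∑ y, K x y * pathW K t y (fun q => P (Fin.cons x q)) := by
  unfold pathW
  rw [← (Fin.consEquiv (fun _ : Fin (t + 2) => α)).sum_comp, Fintype.sum_prod_type]
  rw [Finset.sum_eq_single x]
  · simp_rw [Finset.mul_sum]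
    rw [Finset.sum_comm]
    refine Finset.sum_congr rfl fun q _ => ?_
    rw [Finset.sum_eq_single (q 0)]
    · simp [Fin.consEquiv, Fin.prod_univ_succ]
    · intro b _ hb
      rw [if_neg (fun h => hb h.1.symm), mul_zero]
    · simp
  · intro b _ hb
    refine Finset.sum_eq_zero fun q _ => ?_
    rw [if_neg]
    rintro ⟨h, _⟩
    exact hb (by simpa [Fin.consEquiv] using h)
  · simp

lemma pathW_nonneg_aux {α : Type*} [Fintype α] (K : α → α → ℝ) (hK : ∀ x y, 0 ≤ K x y)
    (t : ℕ) (x : α) (P : (Fin (t + 1) → α) → Prop) : 0 ≤ pathW K t x P := by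
  unfold pathW
  refine Finset.sum_nonneg fun q _ => ?_
  split_ifs
  · exact Finset.prod_nonneg fun s _ => hK _ _
  · exact le_rfl

lemma pathW_le_one_aux {α : Type*} [Fintype α] (K : α → α → ℝ) (hK : ∀ x y, 0 ≤ K x y)
    (h1 : ∀ x, ∑ y, K x y = 1)
    (t : ℕ) : ∀ (x : α) (P : (Fin (t + 1) → α) → Prop), pathW K t x P ≤ 1 := by
  induction t with
  | zero => intro x P; rw [pathW_zero_aux]; split_ifs <;> norm_num
  | succ t ih =>
    intro x P
    rw [pathW_succ_aux, ← h1 x]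
    exact Finset.sum_le_sum fun y _ => mul_le_of_le_one_right (hK x y) (ih y _)

lemma pathW_max_aux {α : Type*} [Fintype α] (K : α → α → ℝ) (hK : ∀ x y, 0 ≤ K x y)
    (h1 : ∀ x, ∑ y, K x y = 1) (V : α → ℝ) (hV : ∀ x, 0 ≤ V x) (c : ℝ) (hc : 0 ≤ c)
    (hd : ∀ x, ∑ y, K x y * V y ≤ V x + c) (D : ℝ) (hD : 0 < D) (t : ℕ) :
    ∀ x : α, pathW K t x (fun q => ∃ τ, D ≤ V (q τ)) ≤ (V x + t * c) / D := by
  induction t with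
  | zero =>
    intro x
    rw [pathW_zero_aux]
    split_ifs with h
    · obtain ⟨_, h⟩ := h
      rw [le_div_iff₀ hD]; simpa using h
    · simpa using div_nonneg (hV x) hD.le
  | succ t ih =>
    intro x
    by_cases hx : D ≤ V x
    · refine (pathW_le_one_aux K hK h1 _ _ _).trans ?_
      rw [le_div_iff₀ hD]
      have : 0 ≤ ((t + 1 : ℕ) : ℝ) * c := by positivity
      linarith
    · rw [pathW_succ_aux]
      have e : ∀ q : Fin (t + 1) → α,
          (∃ τ : Fin (t + 2), D ≤ V ((Fin.cons x q : Fin (t + 2) → α) τ)) ↔ ∃ τ, D ≤ V (q τ) := by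
        intro q
        rw [Fin.exists_fin_succ]
        simp [hx]
      simp_rw [e]
      calc _ ≤ ∑ y, K x y * ((V y + t * c) / D) :=
            Finset.sum_le_sum fun y _ => mul_le_mul_of_nonneg_left (ih y) (hK x y)
        _ = (∑ y, K x y * V y + (∑ y, K x y) * (t * c)) / D := by
            rw [Finset.sum_mul, ← Finset.sum_add_distrib, Finset.sum_div]
            exact Finset.sum_congr rfl fun y _ => by ring
        _ ≤ _ := by
            rw [h1 x]
            refine div_le_div_of_nonneg_right ?_ hD.le
            push_cast
            linarith [hd x]

lemma binomPr_eq_aux (m : ℕ) (p : ℝ) (k : ℕ) :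
    binomPr m p k = (bernsteinPolynomial ℝ m k).eval p := by
  simp [binomPr, bernsteinPolynomial]

lemma binomPr_nonneg_aux (m : ℕ) (p : ℝ) (k : ℕ) (h0 : 0 ≤ p) (h1 : p ≤ 1) :
    0 ≤ binomPr m p k := by
  have : 0 ≤ 1 - p := by linarith
  unfold binomPr; positivity

lemma binomPr_sum_aux (m : ℕ) (p : ℝ) : ∑ k ∈ range (m + 1), binomPr m p k = 1 := by
  simp_rw [binomPr_eq_aux]
  rw [← Polynomial.eval_finsetSum, bernsteinPolynomial.sum]; simp

lemma binomPr_mean_aux (m : ℕ) (p : ℝ) :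
    ∑ k ∈ range (m + 1), binomPr m p k * (k : ℝ) = m * p := by
  have := congrArg (Polynomial.eval p) (bernsteinPolynomial.sum_smul ℝ m)
  rw [Polynomial.eval_finsetSum] at this
  simp_rw [binomPr_eq_aux]
  simpa [mul_comm] using this

lemma binomPr_var_aux (m : ℕ) (p : ℝ) :
    ∑ k ∈ range (m + 1), binomPr m p k * ((m * p - k : ℝ)) ^ 2 = m * p * (1 - p) := by
  have := congrArg (Polynomial.eval p) (bernsteinPolynomial.variance ℝ m)
  rw [Polynomial.eval_finsetSum] at this
  simp_rw [binomPr_eq_aux]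
  simpa [mul_comm, mul_assoc, mul_left_comm] using this

lemma binomTrunc_sum_aux (μ lam : ℕ) (h : μ ≤ lam) (p : ℝ) (f : ℕ → ℝ) :
    ∑ y : Fin (μ + 1), binomTruncPr μ lam p y.val * f y.val
      = ∑ k ∈ range (lam + 1), binomPr lam p k * f (min μ k) := by
  rw [Fin.sum_univ_eq_sum_range (fun j => binomTruncPr μ lam p j * f j), Finset.sum_range_succ,
    ← Finset.sum_range_add_sum_Ico _ (show μ ≤ lam + 1 by omega)]
  congr 1
  · refine Finset.sum_congr rfl fun k hk => ?_
    have hk := Finset.mem_range.1 hk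
    rw [binomTruncPr, if_pos hk, min_eq_right hk.le]
  · rw [binomTruncPr, if_neg (lt_irrefl _), if_pos rfl, Finset.sum_mul]
    refine Finset.sum_congr (by ext; simp) fun k hk => ?_
    rw [min_eq_left]
    simp at hk; omega

lemma binom_drift_aux (lam : ℕ) (p a x : ℝ) (h0 : 0 ≤ p) (h1 : p ≤ 1) (ha : 0 ≤ a)
    (hx : x ≤ lam * p) :
    ∑ k ∈ range (lam + 1), binomPr lam p k * (max (a - k) 0) ^ 2 ≤ (max (a - x) 0) ^ 2 + a := by
  set m : ℝ := lam * p with hm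
  have hm0 : 0 ≤ m := by positivity
  have hv : ∑ k ∈ range (lam + 1), binomPr lam p k * ((m - k : ℝ)) ^ 2 ≤ m := by
    rw [hm, binomPr_var_aux, ← hm]; nlinarith
  have hpos := fun k => binomPr_nonneg_aux lam p k h0 h1
  rcases le_or_gt m a with h | h
  · calc _ ≤ ∑ k ∈ range (lam + 1), binomPr lam p k * (a - k) ^ 2 := by
          refine Finset.sum_le_sum fun k _ => mul_le_mul_of_nonneg_left ?_ (hpos k)
          rcases max_cases (a - (k : ℝ)) 0 with ⟨e, _⟩ | ⟨e, _⟩ <;> rw [e]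
          nlinarith [sq_nonneg (a - (k : ℝ))]
      _ = ∑ k ∈ range (lam + 1), binomPr lam p k * ((m - k : ℝ)) ^ 2
          + (a ^ 2 - m ^ 2) * ∑ k ∈ range (lam + 1), binomPr lam p k
          + 2 * (m - a) * ∑ k ∈ range (lam + 1), binomPr lam p k * (k : ℝ) := by
          rw [Finset.mul_sum, Finset.mul_sum, ← Finset.sum_add_distrib, ← Finset.sum_add_distrib]
          exact Finset.sum_congr rfl fun k _ => by ring
      _ ≤ _ := by
          rw [binomPr_sum_aux, binomPr_mean_aux, ← hm]
          rw [max_eq_left (by linarith)]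
          nlinarith
  · have hmp : 0 < m := by linarith
    calc _ ≤ ∑ k ∈ range (lam + 1), (a / m) ^ 2 * (binomPr lam p k * (m - k) ^ 2) := by
          refine Finset.sum_le_sum fun k _ => ?_
          rw [mul_left_comm]
          refine mul_le_mul_of_nonneg_left ?_ (hpos k)
          rcases max_cases (a - (k : ℝ)) 0 with ⟨e, h'⟩ | ⟨e, _⟩ <;> rw [e]
          · rw [← mul_pow]
            refine pow_le_pow_left₀ h' ?_ 2
            have : a / m * (m - k) = a - a / m * k := by field_simp
            rw [this]
            have h2 : a / m ≤ 1 := (div_le_one hmp).2 h.le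
            have : a / m * k ≤ 1 * (k : ℝ) := by gcongr
            linarith
          · have := mul_nonneg (sq_nonneg (a / m)) (sq_nonneg (m - (k : ℝ)))
            simpa using this
      _ ≤ (a / m) ^ 2 * m := by
          rw [← Finset.mul_sum]; gcongr
      _ = a * (a / m) := by field_simp
      _ ≤ a * 1 := by
          gcongr
          exact (div_le_one hmp).2 h.le
      _ ≤ _ := by nlinarith [sq_nonneg (max (a - x) 0)]

/-- For the Markov chain on `{0,…,μ}` with `X_{t+1} ~ min{μ, Bin(λ, X_t/(eμ))}`
and deterministic start `X₀`, for every `t` and `Δ > 0`, the probability that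
`X_τ < X₀ - Δ` for some `τ ∈ {1,…,t}` is at most `t·X₀/Δ²`. -/
theorem stmt5 (μ lam : ℕ) (hμ : 0 < μ) (hlam : Real.exp 1 * (μ : ℝ) ≤ (lam : ℝ))
    (X₀ : ℕ) (hX₀ : X₀ ≤ μ) (t : ℕ) (Δ : ℝ) (hΔ : 0 < Δ) :
    ∑ path ∈ (univ : Finset (Fin (t + 1) → Fin (μ + 1))).filter
        (fun path => (path 0).val = X₀ ∧
          ∃ τ : Fin (t + 1), 1 ≤ (τ : ℕ) ∧ ((path τ).val : ℝ) < (X₀ : ℝ) - Δ),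
      ∏ s : Fin t,
        binomTruncPr μ lam (((path s.castSucc).val : ℝ) / (Real.exp 1 * (μ : ℝ)))
          (path s.succ).val
      ≤ (t : ℝ) * (X₀ : ℝ) / Δ ^ 2 := by
  have he1 : (1 : ℝ) ≤ Real.exp 1 := Real.one_le_exp (by norm_num)
  have hμ' : (0 : ℝ) < μ := by exact_mod_cast hμ
  have heμ : 0 < Real.exp 1 * (μ : ℝ) := by positivity
  have hle : μ ≤ lam := by
    have : (μ : ℝ) ≤ lam := by nlinarith
    exact_mod_cast this
  set K : Fin (μ + 1) → Fin (μ + 1) → ℝ := fun x y =>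
    binomTruncPr μ lam ((x.val : ℝ) / (Real.exp 1 * (μ : ℝ))) y.val with hKdef
  have hp0 : ∀ x : Fin (μ + 1), 0 ≤ (x.val : ℝ) / (Real.exp 1 * (μ : ℝ)) := fun x => by positivity
  have hp1 : ∀ x : Fin (μ + 1), (x.val : ℝ) / (Real.exp 1 * (μ : ℝ)) ≤ 1 := fun x => by
    rw [div_le_one heμ]
    have : (x.val : ℝ) ≤ μ := by exact_mod_cast Nat.lt_succ_iff.1 x.2
    nlinarith
  have hK : ∀ x y, 0 ≤ K x y := by
    intro x y
    simp only [hKdef, binomTruncPr]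
    split_ifs
    · exact binomPr_nonneg_aux _ _ _ (hp0 x) (hp1 x)
    · exact Finset.sum_nonneg fun k _ => binomPr_nonneg_aux _ _ _ (hp0 x) (hp1 x)
    · exact le_rfl
  have hK1 : ∀ x, ∑ y, K x y = 1 := by
    intro x
    have := binomTrunc_sum_aux μ lam hle ((x.val : ℝ) / (Real.exp 1 * (μ : ℝ))) (fun _ => 1)
    simp only [mul_one, binomPr_sum_aux] at this
    exact this
  set V : Fin (μ + 1) → ℝ := fun x => (max ((X₀ : ℝ) - (x.val : ℝ)) 0) ^ 2 with hVdef
  have hd : ∀ x, ∑ y, K x y * V y ≤ V x + X₀ := by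
    intro x
    have h2 := binomTrunc_sum_aux μ lam hle ((x.val : ℝ) / (Real.exp 1 * (μ : ℝ)))
      (fun j => (max ((X₀ : ℝ) - (j : ℝ)) 0) ^ 2)
    simp only [hKdef, hVdef]
    rw [h2]
    have h3 := binom_drift_aux lam ((x.val : ℝ) / (Real.exp 1 * (μ : ℝ))) X₀ x.val (hp0 x) (hp1 x)
      (Nat.cast_nonneg _) (by
        rw [← mul_div_assoc, le_div_iff₀ heμ, mul_comm]
        gcongr)
    refine le_trans (le_of_eq ?_) h3
    refine Finset.sum_congr rfl fun k _ => ?_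
    have hX : (X₀ : ℝ) ≤ μ := by exact_mod_cast hX₀
    congr 2
    rcases le_total k μ with h | h
    · rw [min_eq_right h]
    · rw [min_eq_left h, max_eq_right (by linarith), max_eq_right]
      have : (μ : ℝ) ≤ k := by exact_mod_cast h
      linarith
  have key := pathW_max_aux K hK hK1 V (fun x => sq_nonneg _) X₀ (Nat.cast_nonneg _) hd (Δ ^ 2)
    (by positivity) t ⟨X₀, Nat.lt_succ_of_le hX₀⟩
  have hV0 : V ⟨X₀, Nat.lt_succ_of_le hX₀⟩ = 0 := by simp [hVdef]
  rw [hV0, zero_add] at key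
  refine le_trans ?_ key
  unfold pathW
  rw [Finset.sum_filter]
  refine Finset.sum_le_sum fun q _ => ?_
  have hpr : 0 ≤ ∏ s : Fin t, K (q s.castSucc) (q s.succ) := Finset.prod_nonneg fun s _ => hK _ _
  by_cases hq : (q 0).val = X₀ ∧ ∃ τ : Fin (t + 1), 1 ≤ (τ : ℕ) ∧ ((q τ).val : ℝ) < (X₀ : ℝ) - Δ
  · rw [if_pos hq, if_pos]
    obtain ⟨hq0, τ, -, hτ⟩ := hq
    refine ⟨Fin.ext hq0, τ, ?_⟩
    simp only [hVdef]
    refine pow_le_pow_left₀ hΔ.le ?_ 2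
    exact le_max_of_le_left (by linarith)
  · rw [if_neg hq]
    split_ifs
    · exact hpr
    · exact le_rfl
end

section
/- Let ε ∈ (0,1) be a constant and let μ, λ : ℕ → ℕ be functions with μ(n) ≤ λ(n) and λ(n) ≤ (1 − ε)·e·μ(n) for all n. Then the expected runtime E[T_n] of the (μ(n), λ(n)) EA on the n-dimensional OneMax function is exponential in n: there exist constants c > 0 and n_0 such that E[T_n] ≥ e^{c·n} for all n ≥ n_0. -/
open Finset
open scoped ENNReal

attribute [local instance] Classical.propDecidable

section Aux

variable {α : Type*} [Fintype α]

noncomputable def vAux (K : α → α → ℝ) (good : α → Prop) : ℕ → α → ℝ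
  | 0, P => if good P then 1 else 0
  | t + 1, P => if good P then ∑ Q, K P Q * vAux K good t Q else 0

theorem vAux_path (K : α → α → ℝ) (good : α → Prop) (t : ℕ) (P : α) :
    ∑ p : Fin t → α, (if ∀ s : Fin (t+1), good ((Fin.cons P p : Fin (t+1) → α) s) then
      ∏ s : Fin t, K ((Fin.cons P p : Fin (t+1) → α) s.castSucc)
        ((Fin.cons P p : Fin (t+1) → α) s.succ) else 0) = vAux K good t P := by
  induction t generalizing P with
  | zero => simp [vAux]
  | succ t ih =>
    rw [← (Fin.consEquiv (fun _ : Fin (t+1) => α)).sum_comp, Fintype.sum_prod_type]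
    simp only [vAux, ← ih]
    split_ifs with h
    · refine Finset.sum_congr rfl fun Q _ => ?_
      rw [Finset.mul_sum]
      refine Finset.sum_congr rfl fun p _ => ?_
      have h1 : (∀ s : Fin (t+1+1), good ((Fin.cons P (Fin.cons Q p : Fin (t+1) → α) :
          Fin (t+1+1) → α) s)) ↔ ∀ s : Fin (t+1), good ((Fin.cons Q p : Fin (t+1) → α) s) := by
        rw [Fin.forall_fin_succ]
        simp only [Fin.cons_zero, Fin.cons_succ, h, true_and]
      have h2 : (∏ s : Fin (t+1), K ((Fin.cons P (Fin.cons Q p : Fin (t+1) → α) :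
          Fin (t+1+1) → α) s.castSucc) ((Fin.cons P (Fin.cons Q p : Fin (t+1) → α) :
          Fin (t+1+1) → α) s.succ)) = K P Q * ∏ s : Fin t,
            K ((Fin.cons Q p : Fin (t+1) → α) s.castSucc)
              ((Fin.cons Q p : Fin (t+1) → α) s.succ) := by
        rw [Fin.prod_univ_succ]
        simp only [Fin.castSucc_zero, Fin.cons_zero, Fin.cons_succ, ← Fin.succ_castSucc]
      by_cases hg : ∀ s : Fin (t+1), good ((Fin.cons Q p : Fin (t+1) → α) s)
      · rw [if_pos hg, ← h2]
        exact if_pos (h1.2 hg)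
      · rw [if_neg hg, mul_zero]
        exact if_neg (fun hh => hg (h1.1 hh))
    · refine Finset.sum_eq_zero fun Q _ => Finset.sum_eq_zero fun p _ => ?_
      rw [if_neg]
      intro h2
      exact h (by simpa using h2 0)

theorem vAux_path' (K : α → α → ℝ) (good : α → Prop) (t : ℕ) :
    ∑ p : Fin (t+1) → α, (if ∀ s, good (p s) then
      ∏ s : Fin t, K (p s.castSucc) (p s.succ) else 0) = ∑ P, vAux K good t P := by
  rw [← (Fin.consEquiv (fun _ : Fin (t+1) => α)).sum_comp, Fintype.sum_prod_type]
  refine Finset.sum_congr rfl fun P _ => ?_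
  rw [← vAux_path]
  rfl

theorem vAux_nonneg (K : α → α → ℝ) (good : α → Prop) (hK : ∀ P Q, 0 ≤ K P Q) (t : ℕ) (P : α) :
    0 ≤ vAux K good t P := by
  induction t generalizing P with
  | zero => simp only [vAux]; split_ifs <;> norm_num
  | succ t ih =>
    simp only [vAux]; split_ifs
    · exact Finset.sum_nonneg fun Q _ => mul_nonneg (hK _ _) (ih _)
    · norm_num

theorem vAux_lower (K : α → α → ℝ) (good : α → Prop) (hK : ∀ P Q, 0 ≤ K P Q)
    (hK1 : ∀ P, ∑ Q, K P Q = 1) (W : α → ℝ) (hW : ∀ P, 0 ≤ W P) (B : ℝ) (hB : 0 ≤ B)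
    (hbad : ∀ P, ¬ good P → 1 ≤ W P) (hd : ∀ P, ∑ Q, K P Q * W Q ≤ W P + B) (t : ℕ) (P : α) :
    1 - ((t + 1 : ℝ) * W P + (t + 1 : ℝ)^2 * B) ≤ vAux K good t P := by
  induction t generalizing P with
  | zero =>
    simp only [vAux]; split_ifs with h
    · have := hW P; push_cast; nlinarith
    · have := hbad P h; push_cast; nlinarith
  | succ t ih =>
    have ht : (0:ℝ) ≤ t := Nat.cast_nonneg t
    by_cases h : good P
    · simp only [vAux, if_pos h]
      have h1 : ∑ Q, K P Q * (1 - ((t + 1 : ℝ) * W Q + (t + 1 : ℝ)^2 * B))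
          ≤ ∑ Q, K P Q * vAux K good t Q :=
        Finset.sum_le_sum fun Q _ => mul_le_mul_of_nonneg_left (ih Q) (hK _ _)
      refine le_trans ?_ h1
      have h2 : ∑ Q, K P Q * (1 - ((t + 1 : ℝ) * W Q + (t + 1 : ℝ)^2 * B))
        = (1 - (t + 1 : ℝ)^2 * B) * ∑ Q, K P Q - (t + 1 : ℝ) * ∑ Q, K P Q * W Q := by
        rw [Finset.mul_sum, Finset.mul_sum, ← Finset.sum_sub_distrib]
        refine Finset.sum_congr rfl fun Q _ => by ring
      rw [h2, hK1]
      have h3 := mul_le_mul_of_nonneg_left (hd P) (by positivity : (0:ℝ) ≤ t + 1)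
      have := hW P
      have := mul_nonneg ht hB
      push_cast
      nlinarith
    · refine le_trans ?_ (vAux_nonneg K good hK _ P)
      have := hbad P h
      have h4 : (0:ℝ) ≤ ((t:ℝ)+1) * W P := by have := hW P; positivity
      have h5 : (0:ℝ) ≤ ((t:ℝ)+1+1)^2 * B := by positivity
      push_cast
      nlinarith

theorem sum_pi_prod {ι : Type*} [Fintype ι] [DecidableEq ι] (p : ι → α → ℝ) :
    ∑ o : ι → α, ∏ j, p j (o j) = ∏ j, ∑ y, p j y := by
  rw [Finset.prod_univ_sum, Fintype.piFinset_univ]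

theorem sum_pi_one {ι : Type*} [Fintype ι] [DecidableEq ι] (p : α → ℝ) (hp : ∑ y, p y = 1)
    (h : α → ℝ) (j₀ : ι) :
    ∑ o : ι → α, (∏ j, p (o j)) * h (o j₀) = ∑ y, p y * h y := by
  have := sum_pi_prod (α := α) (fun (j : ι) y => if j = j₀ then p y * h y else p y)
  have e1 : ∀ o : ι → α, (∏ j, if j = j₀ then p (o j) * h (o j) else p (o j))
      = (∏ j, p (o j)) * h (o j₀) := by
    intro o
    have : ∀ j, (if j = j₀ then p (o j) * h (o j) else p (o j))
      = p (o j) * (if j = j₀ then h (o j) else 1) := by intro j; split_ifs <;> simp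
    simp only [this]
    rw [Finset.prod_mul_distrib, Finset.prod_ite_eq' univ j₀ (fun j => h (o j)), if_pos (Finset.mem_univ _)]
  simp only [e1] at this
  rw [this]
  have e2 : ∀ j, (∑ y, if j = j₀ then p y * h y else p y)
      = if j = j₀ then ∑ y, p y * h y else 1 := by
    intro j; split_ifs <;> simp [hp]
  simp [e2]

end Aux

theorem tau_pow_oneMax {n : ℕ} (τ : ℝ) (y : Pt n) :
    τ ^ oneMax y = ∏ i, (if y i = true then τ else 1) := by
  simp [oneMax, Finset.prod_ite]

theorem oneMax_le {n : ℕ} (y : Pt n) : oneMax y ≤ n := by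
  unfold oneMax
  exact (Finset.card_le_univ _).trans (by simp)

theorem mut_gen (n : ℕ) (τ : ℝ) (x : Pt n) :
    ∑ y, mutProb n x y * τ ^ oneMax y =
      ((1 - 1 / (n:ℝ)) * τ + 1 / n) ^ oneMax x * ((1 - 1 / (n:ℝ)) + τ / n) ^ (n - oneMax x) := by
  simp only [tau_pow_oneMax, mutProb, ← Finset.prod_mul_distrib]
  rw [sum_pi_prod (fun (i : Fin n) (b : Bool) => (if b = x i then 1 - 1 / (n : ℝ) else 1 / (n : ℝ))
    * (if b = true then τ else 1))]
  have e : ∀ i : Fin n, ∑ b : Bool, (if b = x i then 1 - 1 / (n : ℝ) else 1 / (n : ℝ))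
    * (if b = true then τ else 1) = if x i = true then ((1 - 1 / (n:ℝ)) * τ + 1 / n)
      else ((1 - 1 / (n:ℝ)) + τ / n) := by
    intro i
    cases x i <;> simp <;> ring
  rw [Finset.prod_congr rfl fun i _ => e i, Finset.prod_ite]
  simp only [Finset.prod_const]
  have hc : (univ.filter (fun i => ¬ x i = true)).card = n - oneMax x := ?_
  · rw [← hc, ← tau_pow_oneMax]; rfl
  have := Finset.card_filter_add_card_filter_not (s := (univ : Finset (Fin n)))
    (fun i => x i = true)
  simp only [Finset.card_univ, Fintype.card_fin] at this
  unfold oneMax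
  omega

theorem mut_sum (n : ℕ) (x : Pt n) : ∑ y, mutProb n x y = 1 := by
  have := mut_gen n 1 x
  simpa using this

theorem mut_nonneg (n : ℕ) (x y : Pt n) : 0 ≤ mutProb n x y := by
  unfold mutProb
  refine Finset.prod_nonneg fun i _ => ?_
  have : (1:ℝ) ≤ n := by exact_mod_cast (Nat.one_le_iff_ne_zero.2 (by have := i.2; omega))
  split_ifs
  · rw [sub_nonneg, div_le_one (by linarith)]; exact this
  · positivity

theorem off_nonneg (n μ : ℕ) (P : Fin μ → Pt n) (y) : 0 ≤ offProb n μ P y :=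
  div_nonneg (Finset.sum_nonneg fun _ _ => mut_nonneg _ _ _) (Nat.cast_nonneg _)

theorem off_sum_mul (n μ : ℕ) (P : Fin μ → Pt n) (h : Pt n → ℝ) :
    ∑ y, offProb n μ P y * h y = (∑ i, ∑ y, mutProb n (P i) y * h y) / μ := by
  unfold offProb
  rw [Finset.sum_comm, Finset.sum_div]
  refine Finset.sum_congr rfl fun y _ => ?_
  rw [← Finset.sum_mul]; ring

theorem off_sum (n μ : ℕ) (hμ : 0 < μ) (P : Fin μ → Pt n) : ∑ y, offProb n μ P y = 1 := by
  have := off_sum_mul n μ P (fun _ => 1)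
  simp only [mul_one, mut_sum] at this
  rw [this]
  have : (μ:ℝ) ≠ 0 := by positivity
  simp [this]

theorem valid_exists {n μ lam : ℕ} (h : μ ≤ lam) (o : Fin lam → Pt n) :
    ∃ s : Fin μ → Fin lam, validSel o s := by
  let g : Fin lam → ℕᵒᵈ := fun j => OrderDual.toDual (oneMax (o j))
  let σ := Tuple.sort g
  have hm : Monotone (g ∘ σ) := Tuple.monotone_sort g
  refine ⟨fun i => σ (Fin.castLE h i), ?_, ?_⟩
  · intro a b hab
    exact Fin.castLE_injective h (σ.injective hab)
  · intro j hj i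
    have hk : μ ≤ (σ.symm j : ℕ) := by
      by_contra hlt
      push Not at hlt
      apply hj ⟨_, hlt⟩
      simp
    have : Fin.castLE h i ≤ σ.symm j := by
      rw [Fin.le_def]; simp; omega
    have h2 := hm this
    simp only [g, Function.comp, Equiv.apply_symm_apply] at h2
    exact h2

theorem step_mul {n μ lam : ℕ} (P : Fin μ → Pt n) (W : (Fin μ → Pt n) → ℝ) :
    ∑ Q, stepProb n μ lam P Q * W Q = ∑ o : Fin lam → Pt n, offVecProb n μ lam P o *
      ((∑ s ∈ univ.filter (fun s : Fin μ → Fin lam => validSel o s), W (o ∘ s)) /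
      ((univ.filter (fun s : Fin μ → Fin lam => validSel o s)).card : ℝ)) := by
  unfold stepProb
  simp only [Finset.sum_mul]
  rw [Finset.sum_comm]
  refine Finset.sum_congr rfl fun o _ => ?_
  simp only [mul_assoc]
  rw [← Finset.mul_sum]
  congr 1
  simp only [div_mul_eq_mul_div]
  rw [← Finset.sum_div]
  congr 1
  rw [← Finset.sum_fiberwise_of_maps_to (t := univ) (g := fun s => o ∘ s) (by simp)]
  refine Finset.sum_congr rfl fun Q _ => ?_
  rw [Finset.filter_filter, Finset.sum_congr rfl (g := fun _ => W Q), Finset.sum_const, nsmul_eq_mul]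
  intro s hs
  rw [(Finset.mem_filter.1 hs).2.2]

theorem offVec_nonneg (n μ lam : ℕ) (P : Fin μ → Pt n) (o) : 0 ≤ offVecProb n μ lam P o :=
  Finset.prod_nonneg fun _ _ => off_nonneg _ _ _ _

theorem step_nonneg (n μ lam : ℕ) (P Q : Fin μ → Pt n) : 0 ≤ stepProb n μ lam P Q :=
  Finset.sum_nonneg fun _ _ => mul_nonneg (offVec_nonneg _ _ _ _ _) (by positivity)

theorem card_valid_pos {n μ lam : ℕ} (h : μ ≤ lam) (o : Fin lam → Pt n) :
    (0:ℝ) < ((univ.filter (fun s : Fin μ → Fin lam => validSel o s)).card : ℝ) := by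
  obtain ⟨s, hs⟩ := valid_exists h o
  exact_mod_cast Finset.card_pos.2 ⟨s, by simpa using hs⟩

theorem step_sum {n μ lam : ℕ} (hμ : 0 < μ) (h : μ ≤ lam) (P : Fin μ → Pt n) :
    ∑ Q, stepProb n μ lam P Q = 1 := by
  have := step_mul (lam := lam) P (fun _ => 1)
  simp only [mul_one] at this
  rw [this]
  have e : ∀ o : Fin lam → Pt n, offVecProb n μ lam P o *
      ((∑ s ∈ univ.filter (fun s : Fin μ → Fin lam => validSel o s), (1:ℝ)) /
      ((univ.filter (fun s : Fin μ → Fin lam => validSel o s)).card : ℝ)) =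
      ∏ j, offProb n μ P (o j) := by
    intro o
    have := card_valid_pos h o
    rw [Finset.sum_const, nsmul_eq_mul, mul_one, div_self this.ne', mul_one]; rfl
  rw [Finset.sum_congr rfl fun o _ => e o, sum_pi_prod (fun _ y => offProb n μ P y)]
  simp [off_sum n μ hμ]

theorem step_pot {n μ lam : ℕ} (hμ : 0 < μ) (h : μ ≤ lam) (P : Fin μ → Pt n)
    (w : Pt n → ℝ) (hw : ∀ x, 0 ≤ w x) :
    ∑ Q, stepProb n μ lam P Q * (∑ i, w (Q i)) ≤
      (lam / μ : ℝ) * ∑ i, ∑ y, mutProb n (P i) y * w y := by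
  rw [step_mul]
  have e : ∀ o : Fin lam → Pt n, offVecProb n μ lam P o *
      ((∑ s ∈ univ.filter (fun s : Fin μ → Fin lam => validSel o s), ∑ i, w ((o ∘ s) i)) /
      ((univ.filter (fun s : Fin μ → Fin lam => validSel o s)).card : ℝ)) ≤
      ∑ j₀, (∏ j, offProb n μ P (o j)) * w (o j₀) := by
    intro o
    rw [← Finset.mul_sum]
    refine mul_le_mul_of_nonneg_left ?_ (offVec_nonneg n μ lam P o)
    rw [div_le_iff₀ (card_valid_pos h o), mul_comm, ← nsmul_eq_mul]
    refine Finset.sum_le_card_nsmul _ _ _ fun s hs => ?_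
    have hinj := (Finset.mem_filter.1 hs).2.1
    calc ∑ i, w ((o ∘ s) i) = ∑ j ∈ univ.map ⟨s, hinj⟩, w (o j) := by simp
      _ ≤ _ := Finset.sum_le_sum_of_subset_of_nonneg (Finset.subset_univ _) fun _ _ _ => hw _
  refine (Finset.sum_le_sum fun o _ => e o).trans ?_
  rw [Finset.sum_comm]
  simp only [sum_pi_one _ (off_sum n μ hμ P) w, off_sum_mul]
  simp
  apply le_of_eq; ring

/-- bound for one parent -/
theorem mut_bound (n : ℕ) (hn : 0 < n) (τ : ℝ) (hτ : 1 ≤ τ) (x : Pt n) :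
    ∑ y, mutProb n x y * τ ^ oneMax y ≤
      τ ^ oneMax x * Real.exp (-1 + 1/τ + (1 - oneMax x / n) * τ) := by
  have hn' : (0:ℝ) < n := by exact_mod_cast hn
  have hn1 : (1:ℝ) ≤ n := by exact_mod_cast hn
  have h0 : 0 < τ := by linarith
  rw [mut_gen]
  have hk := oneMax_le x
  set k := oneMax x with hkdef
  have hinv : (1:ℝ)/n ≤ 1 := by rw [div_le_one hn']; exact hn1
  have a0 : 0 ≤ (1 - 1 / (n:ℝ)) * τ + 1 / n := by
    have : 0 ≤ (1 - 1 / (n:ℝ)) := by linarith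
    positivity
  have b0 : 0 ≤ (1 - 1 / (n:ℝ)) + τ / n := by
    have : 0 ≤ (1 - 1 / (n:ℝ)) := by linarith
    positivity
  have a1 : (1 - 1 / (n:ℝ)) * τ + 1 / n ≤ τ * Real.exp (-(1 - 1/τ)/n) := by
    have := Real.add_one_le_exp (-(1 - 1/τ)/n)
    refine le_trans (le_of_eq ?_) (mul_le_mul_of_nonneg_left this h0.le)
    field_simp; ring
  have b1 : (1 - 1 / (n:ℝ)) + τ / n ≤ Real.exp ((τ - 1)/n) := by
    have := Real.add_one_le_exp ((τ - 1)/n)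
    refine le_trans (le_of_eq ?_) this
    field_simp; ring
  calc _ ≤ (τ * Real.exp (-(1 - 1/τ)/n)) ^ k * (Real.exp ((τ - 1)/n)) ^ (n - k) := by gcongr
    _ = τ ^ k * Real.exp (k * (-(1 - 1/τ)/n) + ((n:ℝ) - k) * ((τ - 1)/n)) := by
      rw [mul_pow, ← Real.exp_nat_mul, ← Real.exp_nat_mul, mul_assoc, ← Real.exp_add,
        Nat.cast_sub hk]
    _ ≤ _ := by
      refine mul_le_mul_of_nonneg_left (Real.exp_le_exp.2 ?_) (by positivity)
      have hkn : (k:ℝ) ≤ n := by exact_mod_cast hk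
      have : (k * (-(1 - 1/τ)/n) + ((n:ℝ) - k) * ((τ - 1)/n)) =
        -1 + 1/τ + (1 - k/n) * τ - (1 - k/n) * (1/τ) := by
        field_simp; ring
      rw [this]
      have : 0 ≤ (1 - (k:ℝ)/n) * (1/τ) := by
        apply mul_nonneg _ (by positivity)
        rw [sub_nonneg, div_le_one hn']; exact hkn
      linarith

theorem one_bound (ε : ℝ) (hε₁ : 0 < ε) (hε₂ : ε < 1) (n : ℕ) (hn : 0 < n) (x : Pt n) :
    (1 - ε) * Real.exp 1 * ∑ y, mutProb n x y * (2/ε) ^ oneMax y ≤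
      (2/ε) ^ oneMax x + Real.exp (1 + 2/ε) * ((2/ε) ^ n * Real.exp (-(ε^2/4 * Real.log (2/ε)) * n)) := by
  have hτ : 1 < 2/ε := by rw [lt_div_iff₀ hε₁]; linarith
  have hn' : (0:ℝ) < n := by exact_mod_cast hn
  have hb := mut_bound n hn (2/ε) hτ.le x
  have hk := oneMax_le x
  set k := oneMax x with hkdef
  have hkn : (k:ℝ) ≤ n := by exact_mod_cast hk
  have hu0 : 0 ≤ 1 - (k:ℝ)/n := by rw [sub_nonneg, div_le_one hn']; exact hkn
  have hu1 : 1 - (k:ℝ)/n ≤ 1 := by have : 0 ≤ (k:ℝ)/n := by positivity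
                                   linarith
  have h1e : 1 - ε ≤ Real.exp (-ε) := by have := Real.add_one_le_exp (-ε); linarith
  have hpos : 0 ≤ (1 - ε) * Real.exp 1 := mul_nonneg (by linarith) (Real.exp_pos _).le
  set τ := 2/ε with hτd
  have hτ0 : 0 < τ := by linarith
  have hinv : 1/τ = ε/2 := by rw [hτd]; field_simp
  have h2 : (1 - ε) * Real.exp 1 * ∑ y, mutProb n x y * τ ^ oneMax y ≤
      τ ^ k * Real.exp (-ε + ε/2 + (1 - (k:ℝ)/n) * τ) := by
    calc _ ≤ Real.exp (-ε) * Real.exp 1 * (τ ^ k * Real.exp (-1 + 1/τ + (1 - k / n) * τ)) := by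
          gcongr
          exact Finset.sum_nonneg fun y _ => mul_nonneg (mut_nonneg _ _ _) (by positivity)
      _ = _ := by
        rw [hinv, ← Real.exp_add, mul_left_comm, ← Real.exp_add]; ring_nf
  refine h2.trans ?_
  by_cases hc : 1 - (k:ℝ)/n ≤ ε^2/4
  · have : Real.exp (-ε + ε/2 + (1 - (k:ℝ)/n) * τ) ≤ 1 := by
      rw [Real.exp_le_one_iff]
      have h3 : (1 - (k:ℝ)/n) * τ ≤ ε^2/4 * τ := by gcongr
      have h4 : ε^2/4 * τ = ε/2 := by rw [hτd]; field_simp; ring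
      linarith
    have h5 : τ ^ k * Real.exp (-ε + ε/2 + (1 - (k:ℝ)/n) * τ) ≤ τ ^ k :=
      mul_le_of_le_one_right (by positivity) this
    have : 0 ≤ Real.exp (1 + τ) * (τ ^ n * Real.exp (-(ε^2/4 * Real.log τ) * n)) := by positivity
    linarith
  · push Not at hc
    have hlog : 0 < Real.log τ := Real.log_pos hτ
    have h3 : τ ^ k ≤ τ ^ n * Real.exp (-(ε^2/4 * Real.log τ) * n) := by
      have e1 : ∀ m : ℕ, τ ^ m = Real.exp (m * Real.log τ) := by
        intro m; rw [Real.exp_nat_mul, Real.exp_log hτ0]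
      rw [e1, e1, ← Real.exp_add]
      gcongr
      have : (k:ℝ) ≤ (1 - ε^2/4) * n := by
        have : (k:ℝ)/n ≤ 1 - ε^2/4 := by linarith
        rwa [div_le_iff₀ hn'] at this
      nlinarith
    have h4 : Real.exp (-ε + ε/2 + (1 - (k:ℝ)/n) * τ) ≤ Real.exp (1 + τ) := by
      refine Real.exp_le_exp.2 ?_
      have : (1 - (k:ℝ)/n) * τ ≤ 1 * τ := by gcongr
      linarith
    have h5 : τ ^ k * Real.exp (-ε + ε/2 + (1 - (k:ℝ)/n) * τ) ≤
      (τ ^ n * Real.exp (-(ε^2/4 * Real.log τ) * n)) * Real.exp (1 + τ) := by gcongr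
    have : 0 ≤ τ ^ k := by positivity
    linarith

theorem surv_eq (n μ lam t : ℕ) : survProb n μ lam t = ((1 : ℝ) / 2 ^ n) ^ μ *
    ∑ P : Fin μ → Pt n, vAux (stepProb n μ lam) (fun P => ∀ i, P i ≠ allOnes n) t P := by
  rw [← vAux_path', survProb, Finset.sum_filter, Finset.mul_sum]
  refine Finset.sum_congr rfl fun p _ => ?_
  by_cases h : ∀ s i, p s i ≠ allOnes n
  · rw [if_pos h, if_pos h]; rfl
  · rw [if_neg h, if_neg h, mul_zero]

theorem init_sum (n μ : ℕ) (τ : ℝ) : ((1 : ℝ) / 2 ^ n) ^ μ *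
    ∑ P : Fin μ → Pt n, ∑ i, τ ^ oneMax (P i) = μ * ((1 + τ)/2)^n := by
  have hp : ∑ y : Pt n, (1:ℝ)/2^n = 1 := by simp
  have hone : ∑ y : Pt n, (1:ℝ)/2^n * τ ^ oneMax y = ((1 + τ)/2)^n := by
    rw [← Finset.mul_sum]
    simp only [tau_pow_oneMax]
    rw [sum_pi_prod (fun (_ : Fin n) (b : Bool) => if b = true then τ else 1)]
    simp
    rw [div_pow, add_comm]; ring
  rw [Finset.sum_comm, Finset.mul_sum]
  have : ∀ i : Fin μ, ((1 : ℝ) / 2 ^ n) ^ μ * ∑ P : Fin μ → Pt n, τ ^ oneMax (P i)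
      = ((1 + τ)/2)^n := by
    intro i
    rw [← hone, ← sum_pi_one (ι := Fin μ) (fun _ : Pt n => (1:ℝ)/2^n) hp (fun y => τ ^ oneMax y) i,
      Finset.mul_sum]
    simp
  rw [Finset.sum_congr rfl fun i _ => this i]
  simp

theorem init_one (n μ : ℕ) : ((1 : ℝ) / 2 ^ n) ^ μ *
    ∑ P : Fin μ → Pt n, (1:ℝ) = 1 := by
  simp [← mul_pow, ← pow_mul]

theorem surv_lower (ε : ℝ) (hε₁ : 0 < ε) (hε₂ : ε < 1) (n μ lam t : ℕ) (hn : 0 < n)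
    (hμ : 0 < μ) (h : μ ≤ lam) (hlam : (lam : ℝ) ≤ (1 - ε) * Real.exp 1 * (μ : ℝ)) :
    1 - ((t + 1 : ℝ) * (μ * (3/4:ℝ)^n) + (t + 1 : ℝ)^2 *
      (μ * (Real.exp (1 + 2/ε) * Real.exp (-(ε^2/4 * Real.log (2/ε)) * n)))) ≤
      survProb n μ lam t := by
  have hτ : 2 ≤ 2/ε := by rw [le_div_iff₀ hε₁]; linarith
  have hob := one_bound ε hε₁ hε₂ n hn
  have hinv : 1/(2/ε) = ε/2 := by field_simp
  set τ := 2/ε with hτd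
  have hτ0 : 0 < τ := by linarith
  set C := Real.exp (1 + τ)
  set D := Real.exp (-(ε^2/4 * Real.log τ) * n)
  have hC : 0 < C := Real.exp_pos _
  have hD : 0 < D := Real.exp_pos _
  have hμ' : (0:ℝ) < μ := by exact_mod_cast hμ
  have hlow := vAux_lower (stepProb n μ lam) (fun P => ∀ i, P i ≠ allOnes n)
    (step_nonneg n μ lam) (step_sum hμ h) (fun P => ∑ i, (τ ^ oneMax (P i) / τ ^ n))
    (fun P => by positivity) (μ * (C * D)) (by positivity)
    (by
      intro P hP
      simp only [not_forall, not_not] at hP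
      obtain ⟨i, hi⟩ := hP
      have : τ ^ oneMax (P i) / τ ^ n = 1 := by
        rw [hi]
        have : oneMax (allOnes n) = n := by simp [oneMax, allOnes]
        rw [this, div_self (by positivity)]
      rw [← this]
      exact Finset.single_le_sum (f := fun i => τ ^ oneMax (P i) / τ ^ n)
        (fun i _ => by positivity) (Finset.mem_univ i))
    (by
      intro P
      refine (step_pot hμ h P (fun x => τ ^ oneMax x / τ ^ n) (fun x => by positivity)).trans ?_
      have hl : (lam / μ : ℝ) ≤ (1 - ε) * Real.exp 1 := by rwa [div_le_iff₀ hμ']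
      have hnn : 0 ≤ ∑ i, ∑ y, mutProb n (P i) y * (τ ^ oneMax y / τ ^ n) :=
        Finset.sum_nonneg fun i _ => Finset.sum_nonneg fun y _ =>
          mul_nonneg (mut_nonneg _ _ _) (by positivity)
      refine (mul_le_mul_of_nonneg_right hl hnn).trans ?_
      have e : (∑ i, τ ^ oneMax (P i) / τ ^ n) + μ * (C * D) =
        ∑ i, (τ ^ oneMax (P i) / τ ^ n + C * D) := by
        rw [Finset.sum_add_distrib]; simp
      rw [e, Finset.mul_sum]
      refine Finset.sum_le_sum fun i _ => ?_
      have h1 := hob (P i)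
      have h2 : ∑ y, mutProb n (P i) y * (τ ^ oneMax y / τ ^ n) =
        (∑ y, mutProb n (P i) y * τ ^ oneMax y) / τ ^ n := by
        rw [Finset.sum_div]; exact Finset.sum_congr rfl fun y _ => by ring
      rw [h2, ← mul_div_assoc, div_le_iff₀ (by positivity)]
      refine h1.trans (le_of_eq ?_)
      field_simp) t
  rw [surv_eq]
  refine le_trans ?_ (mul_le_mul_of_nonneg_left (Finset.sum_le_sum fun P _ => hlow P)
    (by positivity))
  have hi := init_sum n μ τ
  have ho := init_one n μ
  have e2 : ((1 : ℝ) / 2 ^ n) ^ μ * ∑ P : Fin μ → Pt n, (1 - ((t + 1 : ℝ) *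
      (∑ i, (τ ^ oneMax (P i) / τ ^ n)) + (t + 1 : ℝ)^2 * (μ * (C * D)))) =
      (1 - (t + 1 : ℝ)^2 * (μ * (C * D))) * (((1 : ℝ) / 2 ^ n) ^ μ *
        ∑ P : Fin μ → Pt n, (1:ℝ)) - (t + 1 : ℝ) / τ ^ n * (((1 : ℝ) / 2 ^ n) ^ μ *
          ∑ P : Fin μ → Pt n, ∑ i, τ ^ oneMax (P i)) := by
    simp only [Finset.mul_sum]
    rw [← Finset.sum_sub_distrib]
    refine Finset.sum_congr rfl fun P _ => ?_
    simp only [← Finset.mul_sum, ← Finset.sum_div]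
    ring
  rw [e2, ho, hi]
  have h3 : ((1 + τ)/2)^n / τ ^ n ≤ (3/4:ℝ)^n := by
    rw [← div_pow]
    refine pow_le_pow_left₀ (by positivity) ?_ n
    rw [div_div, div_le_div_iff₀ (by positivity) (by norm_num)]
    linarith
  have h4 := mul_le_mul_of_nonneg_left h3 (by positivity : 0 ≤ (t + 1 : ℝ) * μ)
  have h5 : (t + 1 : ℝ) / τ ^ n * (μ * ((1 + τ)/2)^n) = (t + 1 : ℝ) * μ * (((1 + τ)/2)^n / τ ^ n) := by
    ring
  rw [h5]
  linarith

/-- If `λ(n) ≤ (1-ε) e μ(n)` for a constant `ε ∈ (0,1)`, then the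
expected runtime of the (μ,λ) EA on OneMax is exponential in `n`. -/
theorem stmt7 (ε : ℝ) (hε₁ : 0 < ε) (hε₂ : ε < 1) (μ lam : ℕ → ℕ)
    (hμpos : ∀ n, 0 < μ n) (hμle : ∀ n, μ n ≤ lam n)
    (hlam : ∀ n, (lam n : ℝ) ≤ (1 - ε) * Real.exp 1 * (μ n : ℝ)) :
    ∃ c : ℝ, 0 < c ∧ ∃ n₀ : ℕ, ∀ n ≥ n₀,
      ENNReal.ofReal (Real.exp (c * (n : ℝ))) ≤ expRuntime n (μ n) (lam n) := by
  have hτ : 1 < 2/ε := by rw [lt_div_iff₀ hε₁]; linarith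
  have hlog : 0 < Real.log (2/ε) := Real.log_pos hτ
  have hlog43 : 0 < Real.log (4/3) := Real.log_pos (by norm_num)
  obtain ⟨γ, hγ0, hγ1, hγ2⟩ : ∃ γ : ℝ, 0 < γ ∧ γ ≤ Real.log (4/3) ∧ γ ≤ ε^2/4 * Real.log (2/ε) :=
    ⟨min (Real.log (4/3)) (ε^2/4 * Real.log (2/ε)), lt_min hlog43 (by positivity),
      min_le_left _ _, min_le_right _ _⟩
  set C := Real.exp (1 + 2/ε) with hCd
  have hC : 0 < C := Real.exp_pos _
  have hc : 0 < γ/4 := by positivity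
  have htend : Filter.Tendsto (fun n : ℕ => Real.exp (γ/4 * n)) Filter.atTop Filter.atTop :=
    Real.tendsto_exp_atTop.comp (tendsto_natCast_atTop_atTop.const_mul_atTop hc)
  obtain ⟨n₁, hn₁⟩ := Filter.eventually_atTop.1 (htend.eventually_ge_atTop (18 * (1 + C)))
  refine ⟨γ/4, hc, max n₁ 1, fun n hn => ?_⟩
  have hn1 : 1 ≤ n := le_trans (le_max_right _ _) hn
  have hE := hn₁ n (le_trans (le_max_left _ _) hn)
  set E := Real.exp (γ/4 * n) with hEd
  have hE1 : 1 ≤ E := Real.one_le_exp (by positivity)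
  unfold expRuntime
  by_cases hbig : E ≤ μ n
  · refine le_trans ?_ le_self_add
    rw [← ENNReal.ofReal_natCast]
    exact ENNReal.ofReal_le_ofReal hbig
  · push Not at hbig
    refine le_trans ?_ le_add_self
    have hlam1 : (1 : ℝ≥0∞) ≤ lam n := by
      exact_mod_cast (hμpos n).trans_le (hμle n)
    refine le_trans ?_ (le_mul_of_one_le_left (zero_le) hlam1)
    unfold expGens
    set N := ⌈2 * E⌉₊ with hN
    have hN1 : 2 * E ≤ N := Nat.le_ceil _
    have hN2 : (N:ℝ) ≤ 3 * E := by
      have := Nat.ceil_lt_add_one (show 0 ≤ 2 * E by linarith)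
      linarith
    have hr1 : (3/4:ℝ)^n ≤ Real.exp (-γ * n) := by
      have : (3/4:ℝ) = Real.exp (-Real.log (4/3)) := by
        rw [Real.exp_neg, Real.exp_log (by norm_num)]; norm_num
      rw [this, ← Real.exp_nat_mul]
      refine Real.exp_le_exp.2 ?_
      have : (0:ℝ) ≤ n := by positivity
      nlinarith
    have hr2 : Real.exp (-(ε^2/4 * Real.log (2/ε)) * n) ≤ Real.exp (-γ * n) := by
      gcongr
    have hr3 : E * E * E * E * Real.exp (-γ * n) = 1 := by
      rw [hEd]; simp only [← Real.exp_add]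
      rw [Real.exp_eq_one_iff]; ring
    set R := Real.exp (-γ * n) with hR
    have hR0 : 0 < R := Real.exp_pos _
    have hs : ∀ t ∈ Finset.range N, ENNReal.ofReal (1/2) ≤
        ENNReal.ofReal (survProb n (μ n) (lam n) t) := by
      intro t ht
      refine ENNReal.ofReal_le_ofReal ?_
      refine le_trans ?_ (surv_lower ε hε₁ hε₂ n (μ n) (lam n) t hn1 (hμpos n) (hμle n) (hlam n))
      have htN : (t + 1 : ℝ) ≤ 3 * E := by
        have : ((t + 1 : ℕ) : ℝ) ≤ N := by exact_mod_cast Finset.mem_range.1 ht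
        push_cast at this; linarith
      have ht0 : (0:ℝ) ≤ t := Nat.cast_nonneg t
      have hA : (t + 1 : ℝ) * (μ n * (3/4:ℝ)^n) ≤ (3 * E)^2 * (E * R) := by
        have : (t + 1 : ℝ) ≤ (3 * E)^2 := by nlinarith
        gcongr
      have hB : (t + 1 : ℝ)^2 * (μ n * (C * Real.exp (-(ε^2/4 * Real.log (2/ε)) * n)))
          ≤ (3 * E)^2 * (E * (C * R)) := by
        gcongr
      have hfin : (3 * E)^2 * (E * R) + (3 * E)^2 * (E * (C * R)) ≤ 1/2 := by
        have e : (3 * E)^2 * (E * R) + (3 * E)^2 * (E * (C * R)) =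
          (18 * (1 + C)) * (E * E * E * R) / 2 := by ring
        have : (18 * (1 + C)) * (E * E * E * R) ≤ E * (E * E * E * R) := by gcongr
        have : E * (E * E * E * R) = 1 := by rw [← hr3]; ring
        linarith
      linarith
    calc ENNReal.ofReal E ≤ ENNReal.ofReal (N * (1/2)) := ENNReal.ofReal_le_ofReal (by linarith)
      _ = ∑ t ∈ Finset.range N, ENNReal.ofReal (1/2) := by
        rw [Finset.sum_const, Finset.card_range, nsmul_eq_mul, ENNReal.ofReal_mul (by positivity),
          ENNReal.ofReal_natCast]
      _ ≤ ∑ t ∈ Finset.range N, ENNReal.ofReal (survProb n (μ n) (lam n) t) :=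
        Finset.sum_le_sum hs
      _ ≤ _ := ENNReal.sum_le_tsum _
end

section
/- Let ε ∈ (0,1), τ = 4e/ε, α = 1 − (1/τ)·ln(1 + 1/τ), and f_0 = ⌈α·n⌉. Then for every n ≥ 1 and every x ∈ {0,1}^n with f(x) ≥ f_0 (f being the OneMax fitness), the expected potential of a mutated copy of x satisfies E[g(M(x))] ≤ (1/e)·(1 + ε)·g(x). -/
open Finset
open scoped ENNReal

attribute [local instance] Classical.propDecidable

/-- With `τ = 4e/ε`, `α = 1 - (1/τ)ln(1 + 1/τ)` and `f₀ = ⌈αn⌉`, for every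
`x` with `f(x) ≥ f₀` one has `E[g(M(x))] ≤ (1/e)(1+ε) g(x)`. -/
theorem stmt9 (ε τ α : ℝ) (hε₁ : 0 < ε) (hε₂ : ε < 1)
    (hτ : τ = 4 * Real.exp 1 / ε)
    (hα : α = 1 - (1 / τ) * Real.log (1 + 1 / τ))
    (n : ℕ) (hn : 1 ≤ n) (x : Pt n) (hx : ⌈α * (n : ℝ)⌉₊ ≤ oneMax x) :
    ∑ y : Pt n, mutProb n x y * gPot n τ ⌈α * (n : ℝ)⌉₊ y
      ≤ (1 / Real.exp 1) * (1 + ε) * gPot n τ ⌈α * (n : ℝ)⌉₊ x := by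
  have he : 2 ≤ Real.exp 1 := by
    have := Real.add_one_le_exp (1:ℝ); linarith
  have hτ0 : 0 < τ := by rw [hτ]; positivity
  have hετ : τ * ε = 4 * Real.exp 1 := by rw [hτ]; field_simp
  have hu : 8 ≤ τ * ε := by linarith
  have hτ1 : 1 < τ := by nlinarith
  set f₀ := ⌈α * (n : ℝ)⌉₊ with hf₀
  have hn0 : (0:ℝ) < n := by exact_mod_cast hn
  have hd1 : 1 / (n:ℝ) ≤ 1 := by
    rw [div_le_one hn0]; exact_mod_cast hn
  have hd0 : 0 < 1 / (n:ℝ) := by positivity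
  have hτf : (0:ℝ) < τ ^ f₀ := by positivity
  have hpow : ∀ y : Pt n, τ ^ oneMax y = ∏ i, (if y i = true then τ else 1) := by
    intro y
    rw [Finset.prod_ite]
    simp [oneMax]
  have hmut : ∀ y, 0 ≤ mutProb n x y := by
    intro y
    unfold mutProb
    apply Finset.prod_nonneg
    intro i _
    split_ifs <;> linarith
  have hg : ∀ y : Pt n, gPot n τ f₀ y * τ ^ f₀ ≤ τ ^ oneMax y := by
    intro y
    unfold gPot
    split_ifs with h
    · rw [← pow_add, Nat.sub_add_cancel h]
    · rw [zero_mul]; positivity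
  have hgx : gPot n τ f₀ x * τ ^ f₀ = τ ^ oneMax x := by
    unfold gPot
    rw [if_pos hx, ← pow_add, Nat.sub_add_cancel hx]
  have hcard : (univ.filter (fun i => ¬ x i = true)).card + oneMax x = n := by
    have := Finset.card_filter_add_card_filter_not (s := (univ : Finset (Fin n))) (fun i => x i = true)
    simp only [Finset.card_univ, Fintype.card_fin] at this
    unfold oneMax
    rw [add_comm]
    convert this
  have hE : ∑ y : Pt n, mutProb n x y * τ ^ oneMax y
      = ((1 - 1 / (n:ℝ)) * τ + 1 / n) ^ oneMax x
        * ((1 - 1 / (n:ℝ)) + 1 / n * τ) ^ (n - oneMax x) := by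
    have h1 : ∀ y : Pt n, mutProb n x y * τ ^ oneMax y
        = ∏ i, ((if y i = x i then 1 - 1 / (n : ℝ) else 1 / (n : ℝ))
          * (if y i = true then τ else 1)) := by
      intro y
      rw [hpow, mutProb, ← Finset.prod_mul_distrib]
    simp_rw [h1]
    rw [← Fintype.prod_sum (fun (i : Fin n) (b : Bool) =>
      ((if b = x i then 1 - 1 / (n : ℝ) else 1 / (n : ℝ)) * (if b = true then τ else 1)))]
    have h2 : ∀ i : Fin n, ∑ b : Bool,
        ((if b = x i then 1 - 1 / (n : ℝ) else 1 / (n : ℝ)) * (if b = true then τ else 1))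
        = if x i = true then ((1 - 1 / (n:ℝ)) * τ + 1 / n)
          else ((1 - 1 / (n:ℝ)) + 1 / n * τ) := by
      intro i
      cases h : x i <;> simp [add_comm]
    simp_rw [h2]
    rw [Finset.prod_ite, Finset.prod_const, Finset.prod_const]
    congr 2
    omega
  have hA : (1 - 1 / (n:ℝ)) * τ + 1 / n ≤ τ * Real.exp (-(1 / n) * (1 - 1 / τ)) := by
    have := Real.add_one_le_exp (-(1 / (n:ℝ)) * (1 - 1 / τ))
    have h2 := mul_le_mul_of_nonneg_left this hτ0.le
    refine le_trans (le_of_eq ?_) h2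
    field_simp
    ring
  have hB : (1 - 1 / (n:ℝ)) + 1 / n * τ ≤ Real.exp ((1 / n) * (τ - 1)) := by
    have := Real.add_one_le_exp ((1 / (n:ℝ)) * (τ - 1))
    linarith
  have hA0 : 0 ≤ (1 - 1 / (n:ℝ)) * τ + 1 / n := by
    have : 0 ≤ (1 - 1 / (n:ℝ)) * τ := mul_nonneg (by linarith) hτ0.le
    linarith
  have hB0 : 0 ≤ (1 - 1 / (n:ℝ)) + 1 / n * τ := by
    have : 0 ≤ 1 / (n:ℝ) * τ := by positivity
    linarith
  have hk : oneMax x ≤ n := by omega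
  have hfin : ((1 - 1 / (n:ℝ)) * τ + 1 / n) ^ oneMax x
        * ((1 - 1 / (n:ℝ)) + 1 / n * τ) ^ (n - oneMax x)
      ≤ (1 / Real.exp 1) * (1 + ε) * τ ^ oneMax x := by
    have h1 := mul_le_mul (pow_le_pow_left₀ hA0 hA (oneMax x))
      (pow_le_pow_left₀ hB0 hB (n - oneMax x)) (by positivity) (by positivity)
    refine h1.trans ?_
    rw [mul_pow, ← Real.exp_nat_mul, ← Real.exp_nat_mul, mul_assoc, ← Real.exp_add,
      mul_comm]
    apply mul_le_mul_of_nonneg_right _ (by positivity)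
    rw [Nat.cast_sub hk]
    have hkα : α * n ≤ oneMax x := (Nat.le_ceil _).trans (by exact_mod_cast hx)
    have hL : Real.log (1 + 1 / τ) ≤ 1 / τ := by
      have := Real.log_le_sub_one_of_pos (x := 1 + 1 / τ) (by positivity)
      linarith
    have hz : 1 - (oneMax x : ℝ) / n ≤ 1 / τ * (1 / τ) := by
      have h3 : α ≤ (oneMax x : ℝ) / n := by rwa [le_div_iff₀ hn0]
      have h4 : 1 / τ * Real.log (1 + 1 / τ) ≤ 1 / τ * (1 / τ) :=
        mul_le_mul_of_nonneg_left hL (by positivity)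
      linarith
    have hz0 : 0 ≤ 1 - (oneMax x : ℝ) / n := by
      rw [sub_nonneg, div_le_one hn0]; exact_mod_cast hk
    have hexp : (oneMax x : ℝ) * (-(1 / n) * (1 - 1 / τ)) + ((n:ℝ) - oneMax x) * ((1 / n) * (τ - 1))
        ≤ -1 + 2 / τ := by
      have e1 : (oneMax x : ℝ) * (-(1 / n) * (1 - 1 / τ)) + ((n:ℝ) - oneMax x) * ((1 / n) * (τ - 1))
        = -1 + 1 / τ + (1 - (oneMax x : ℝ) / n) * (τ - 1 / τ) := by
        field_simp
        ring
      have e2 : (1 - (oneMax x : ℝ) / n) * (τ - 1 / τ) ≤ (1 / τ * (1 / τ)) * τ := by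
        apply mul_le_mul hz _ _ (by positivity)
        · have : 0 < 1 / τ := by positivity
          linarith
        · have : 1 / τ ≤ 1 := by rw [div_le_one hτ0]; exact hτ1.le
          linarith
      have e3 : (1 / τ * (1 / τ)) * τ = 1 / τ := by field_simp
      rw [e1]
      have e4 : 2 / τ = 1 / τ + 1 / τ := by ring
      linarith
    refine (Real.exp_le_exp.mpr hexp).trans ?_
    rw [Real.exp_add, Real.exp_neg, ← one_div]
    apply mul_le_mul_of_nonneg_left _ (by positivity)
    have hv : 2 / τ ≤ ε / 4 := by
      rw [div_le_div_iff₀ hτ0 (by norm_num)]; linarith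
    have h5 := Real.add_one_le_exp (-(2 / τ))
    rw [Real.exp_neg] at h5
    have h6 : 0 < 1 - 2 / τ := by linarith
    have h7 : Real.exp (2 / τ) ≤ (1 - 2 / τ)⁻¹ := by
      rw [le_inv_comm₀ (Real.exp_pos _) h6]; linarith
    refine h7.trans ?_
    rw [inv_le_iff_one_le_mul₀ h6]
    nlinarith
  refine le_of_mul_le_mul_right ?_ hτf
  rw [Finset.sum_mul, mul_assoc (1 / Real.exp 1 * (1 + ε)), hgx]
  calc ∑ y : Pt n, mutProb n x y * gPot n τ f₀ y * τ ^ f₀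
      ≤ ∑ y : Pt n, mutProb n x y * τ ^ oneMax y := by
        apply Finset.sum_le_sum
        intro y _
        rw [mul_assoc]
        exact mul_le_mul_of_nonneg_left (hg y) (hmut y)
    _ ≤ _ := by rw [hE]; exact hfin
end

section
/- Let ε ∈ (0,1), τ = 4e/ε, α = 1 − (1/τ)·ln(1 + 1/τ), and f_0 = ⌈α·n⌉. If n is large enough, then for every x ∈ {0,1}^n with f(x) < f_0 one has E[g(M(x))] ≤ 2. -/
open Finset
open scoped ENNReal

attribute [local instance] Classical.propDecidable

theorem aux_card {n : ℕ} (x : Pt n) (τ : ℝ) :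
    τ ^ oneMax x = ∏ i : Fin n, (if x i = true then τ else 1) := by
  unfold oneMax
  rw [Finset.prod_ite]
  simp

theorem aux_sum_s10 {n : ℕ} (hn : 1 ≤ n) (x : Pt n) (τ : ℝ) (hτ : 1 ≤ τ) :
    ∑ y : Pt n, mutProb n x y * τ ^ oneMax y
      ≤ τ ^ oneMax x * Real.exp ((τ - 1) / n) ^ (n - oneMax x) := by
  have hn' : (1 : ℝ) ≤ n := by exact_mod_cast hn
  have hn0 : (0 : ℝ) < 1 / n := by positivity
  have hn1 : 1 / (n : ℝ) ≤ 1 := by rw [div_le_one (by linarith)]; exact hn'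
  have h1 : ∀ y : Pt n, mutProb n x y * τ ^ oneMax y =
      ∏ i : Fin n, (if y i = x i then 1 - 1 / (n : ℝ) else 1 / (n : ℝ)) *
        (if y i = true then τ else 1) := by
    intro y
    rw [aux_card, mutProb, Finset.prod_mul_distrib]
  rw [Finset.sum_congr rfl (fun y _ => h1 y)]
  have h2 := Finset.prod_univ_sum (fun _ : Fin n => (Finset.univ : Finset Bool))
    (fun i b => (if b = x i then 1 - 1 / (n : ℝ) else 1 / (n : ℝ)) *
        (if b = true then τ else 1))
  rw [Fintype.piFinset_univ] at h2
  rw [← h2]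
  have h3 : τ ^ oneMax x * Real.exp ((τ - 1) / n) ^ (n - oneMax x) =
      ∏ i : Fin n, (if x i = true then τ else Real.exp ((τ - 1) / n)) := by
    rw [Finset.prod_ite]
    have hc : (univ.filter (fun i => ¬ x i = true)).card = n - oneMax x := by
      have := Finset.card_filter_add_card_filter_not (s := (univ : Finset (Fin n)))
        (fun i => x i = true)
      simp only [Finset.card_univ, Fintype.card_fin] at this
      unfold oneMax
      omega
    rw [Finset.prod_const, Finset.prod_const, hc]
    rfl
  rw [h3]
  apply Finset.prod_le_prod
  · intro i _
    apply Finset.sum_nonneg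
    intro b _
    apply mul_nonneg
    · split_ifs <;> linarith
    · split_ifs <;> linarith
  · intro i _
    rw [Fintype.sum_bool]
    cases hx : x i
    · simp only [Bool.true_eq_false, Bool.false_eq_true, if_true, if_false]
      have := Real.add_one_le_exp ((τ - 1) / n)
      have e : (τ - 1) / (n : ℝ) = τ * (1 / n) - 1 / n := by ring
      rw [e] at this ⊢
      linarith
    · simp only [Bool.false_eq_true, if_true, if_false]
      nlinarith

/-- With `τ = 4e/ε`, `α = 1 - (1/τ)ln(1 + 1/τ)` and `f₀ = ⌈αn⌉`, for all
sufficiently large `n` and every `x` with `f(x) < f₀` one has `E[g(M(x))] ≤ 2`. -/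
theorem stmt10 (ε τ α : ℝ) (hε₁ : 0 < ε) (hε₂ : ε < 1)
    (hτ : τ = 4 * Real.exp 1 / ε)
    (hα : α = 1 - (1 / τ) * Real.log (1 + 1 / τ)) :
    ∃ n₀ : ℕ, ∀ n ≥ n₀, ∀ x : Pt n, oneMax x < ⌈α * (n : ℝ)⌉₊ →
      ∑ y : Pt n, mutProb n x y * gPot n τ ⌈α * (n : ℝ)⌉₊ y ≤ 2 := by
  have he : (1 : ℝ) + 1 ≤ Real.exp 1 := Real.add_one_le_exp 1
  have hτe : Real.exp 1 ≤ τ := by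
    rw [hτ, le_div_iff₀ hε₁]
    nlinarith
  have hτ1 : 1 ≤ τ := by linarith
  have hτ0 : 0 < τ := by linarith
  refine ⟨⌈τ⌉₊ + 1, fun n hn x hx => ?_⟩
  have hn1 : 1 ≤ n := by omega
  have hnτ : τ ≤ n := (Nat.le_ceil τ).trans (by exact_mod_cast (by omega : ⌈τ⌉₊ ≤ n))
  have hn0 : (0 : ℝ) < n := by linarith
  have hα1 : α * n ≤ (⌈α * (n : ℝ)⌉₊ : ℝ) := Nat.le_ceil _
  set f₀ := ⌈α * (n : ℝ)⌉₊ with hf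
  have hk : oneMax x ≤ n := by
    unfold oneMax
    exact (Finset.card_le_univ _).trans (by simp)
  have hb : ∀ y : Pt n, mutProb n x y * gPot n τ f₀ y ≤ (mutProb n x y * τ ^ oneMax y) / τ ^ f₀ := by
    intro y
    rw [mul_div_assoc]
    apply mul_le_mul_of_nonneg_left
    · unfold gPot
      split_ifs with h
      · rw [pow_sub₀ _ hτ0.ne' h]; rfl
      · positivity
    · unfold mutProb
      apply Finset.prod_nonneg
      intro i _
      have : 1 / (n : ℝ) ≤ 1 := by rw [div_le_one hn0]; exact_mod_cast hn1
      split_ifs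
      · linarith
      · positivity
  refine (Finset.sum_le_sum (fun y _ => hb y)).trans ?_
  rw [← Finset.sum_div, div_le_iff₀ (by positivity)]
  refine (aux_sum_s10 hn1 x τ hτ1).trans ?_
  obtain ⟨d, hd⟩ := Nat.exists_eq_add_of_lt hx
  have hfd : f₀ = oneMax x + (d + 1) := by omega
  rw [hfd, pow_add, mul_left_comm]
  apply mul_le_mul_of_nonneg_left _ (by positivity)
  have hl : Real.log (1 + 1 / τ) ≥ 0 := Real.log_nonneg (by
    have : 0 < 1 / τ := by positivity
    linarith)
  have hcast : (f₀ : ℝ) = oneMax x + (d + 1) := by rw [hfd]; push_cast; ring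
  have hexp : ((n - oneMax x : ℕ) : ℝ) * ((τ - 1) / n) ≤
      Real.log (1 + 1 / τ) + (d + 1 : ℕ) * 1 := by
    rw [Nat.cast_sub hk]
    have hm : (n : ℝ) - oneMax x ≤ n * ((1 / τ) * Real.log (1 + 1 / τ)) + (d + 1) := by
      rw [hα] at hα1
      rw [hcast] at hα1
      nlinarith
    have hq : 0 ≤ (τ - 1) / (n : ℝ) := div_nonneg (by linarith) hn0.le
    have hq1 : (τ - 1) / (n : ℝ) ≤ 1 := by rw [div_le_one hn0]; linarith
    calc ((n : ℝ) - oneMax x) * ((τ - 1) / n)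
        ≤ (n * ((1 / τ) * Real.log (1 + 1 / τ)) + (d + 1)) * ((τ - 1) / n) :=
          mul_le_mul_of_nonneg_right hm hq
      _ = ((τ - 1) / τ) * Real.log (1 + 1 / τ) + (d + 1) * ((τ - 1) / n) := by
          field_simp
      _ ≤ 1 * Real.log (1 + 1 / τ) + (d + 1) * 1 := by
          have : (τ - 1) / τ ≤ 1 := by rw [div_le_one hτ0]; linarith
          gcongr
      _ = _ := by push_cast; ring
  rw [← Real.exp_nat_mul]
  refine (Real.exp_le_exp.mpr hexp).trans ?_
  rw [Real.exp_add, Real.exp_nat_mul, Real.exp_log (by positivity)]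
  have h2 : 1 + 1 / τ ≤ 2 := by
    have : 1 / τ ≤ 1 := by rw [div_le_one hτ0]; exact hτ1
    linarith
  gcongr
end
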